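/- arXiv:1102.3621 — 3 statements merged into one kernel-verified Lean document; each statement's English description precedes it below -/
import Mathlib

section
/- Let μ be a probability measure on ℝ having a density with respect to Lebesgue measure and finite third moment, and let σ² = Var_μ(x). Let γ be the standard Gaussian measure on ℝ, whose isoperimetric function is I_γ(t) = φ(Φ^{−1}(t)), where φ and Φ are the standard Gaussian density and distribution function. Then for every t ∈ [0,1], the infinite-dimensional isoperimetric function satisfies I_{μ^∞}(t) = inf_{N ≥ 1} I_{μ^N}(t) ≤ (1/σ) · I_γ(t). -/
open MeasureTheory ProbabilityTheory Real
open scoped ENNReal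

/-- The boundary measure (Minkowski content) of a set `A`:
`τ⁺(∂A) = lim_{h→0⁺} (τ(A_h) - τ(A))/h` where `A_h = {x : dist(x,A) ≤ h}`. -/
noncomputable def boundaryMeasure {E : Type*} [MeasurableSpace E] [PseudoEMetricSpace E]
    (τ : Measure E) (A : Set E) : ℝ≥0∞ :=
  Filter.liminf (fun h : ℝ => (τ (Metric.cthickening h A) - τ A) / ENNReal.ofReal h)
    (nhdsWithin 0 (Set.Ioi 0))

/-- The isoperimetric function `I_τ(y) = inf { τ⁺(∂A) : A Borel, τ(A) = y }`. -/
noncomputable def isopFun {E : Type*} [MeasurableSpace E] [PseudoEMetricSpace E]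
    (τ : Measure E) (y : ℝ) : ℝ≥0∞ :=
  sInf {b | ∃ A : Set E, MeasurableSet A ∧ (τ A).toReal = y ∧ b = boundaryMeasure τ A}

section
open Set Filter Topology

theorem isopFun_le_boundaryMeasure {E : Type*} [MeasurableSpace E] [PseudoEMetricSpace E]
    {τ : Measure E} {A : Set E} {t : ℝ} (hA : MeasurableSet A) (ht : τ.real A = t) :
    isopFun τ t ≤ boundaryMeasure τ A :=
  sInf_le ⟨A, hA, ht, rfl⟩

/-- Eventual linear growth of the closed thickenings bounds the boundary measure from above. -/
theorem boundaryMeasure_le_ofReal {E : Type*} [MeasurableSpace E] [PseudoEMetricSpace E]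
    {τ : Measure E} [IsFiniteMeasure τ] {A : Set E} {C : ℝ} (hC : 0 ≤ C)
    (h : ∀ᶠ h in 𝓝[>] (0 : ℝ), τ.real (Metric.cthickening h A) ≤ τ.real A + C * h) :
    boundaryMeasure τ A ≤ ENNReal.ofReal C := by
  refine liminf_le_of_frequently_le' (Eventually.frequently ?_)
  filter_upwards [h, self_mem_nhdsWithin] with h hh hpos
  have hpos : 0 < h := hpos
  refine ENNReal.div_le_of_le_mul ?_
  rw [tsub_le_iff_left, ← ENNReal.ofReal_mul hC, ← ofReal_measureReal (μ := τ) (s := A),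
    ← ofReal_measureReal (μ := τ) (s := Metric.cthickening h A),
    ← ENNReal.ofReal_add measureReal_nonneg (by positivity)]
  exact ENNReal.ofReal_le_ofReal hh

/-- Eventual linear growth of the closed thickenings bounds the boundary measure from below. -/
theorem ofReal_le_boundaryMeasure {E : Type*} [MeasurableSpace E] [PseudoEMetricSpace E]
    {τ : Measure E} [IsFiniteMeasure τ] {A : Set E} {C : ℝ}
    (h : ∀ ε > 0, ∀ᶠ h in 𝓝[>] (0 : ℝ),
      τ.real A + (C - ε) * h ≤ τ.real (Metric.cthickening h A)) :
    ENNReal.ofReal C ≤ boundaryMeasure τ A := by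
  refine ENNReal.le_of_forall_pos_le_add fun ε hε _ => ?_
  rw [← tsub_le_iff_right, ← ENNReal.ofReal_coe_nnreal, ← ENNReal.ofReal_sub _ ε.coe_nonneg]
  refine le_liminf_of_le (by isBoundedDefault) ?_
  filter_upwards [h ε hε, self_mem_nhdsWithin] with h hh hpos
  have hpos : 0 < h := hpos
  rw [ENNReal.le_div_iff_mul_le (by simp [hpos]) (by simp)]
  rw [← ENNReal.ofReal_mul' hpos.le, ← ofReal_measureReal (μ := τ) (s := A),
    ← ofReal_measureReal (μ := τ) (s := Metric.cthickening h A),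
    ← ENNReal.ofReal_sub _ measureReal_nonneg]
  exact ENNReal.ofReal_le_ofReal (by linarith)

/-- A monotone function is differentiable at some point of any interval with derivative at most
its average slope. -/
theorem Monotone.exists_mem_Ioo_deriv_lt {F : ℝ → ℝ} (hF : Monotone F) {a b d : ℝ} (hab : a < b)
    (hd : F b - F a < d * (b - a)) :
    ∃ x ∈ Ioo a b, DifferentiableAt ℝ F x ∧ deriv F x < d := by
  have hint := (hF.monotoneOn (uIcc a b)).intervalIntegrable_deriv
  have hle := (hF.monotoneOn (uIcc a b)).intervalIntegral_deriv_mem_uIcc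
  rw [uIcc_of_le (by linarith [hF hab.le])] at hle
  rw [intervalIntegral.integral_of_le hab.le] at hle
  rw [intervalIntegrable_iff_integrableOn_Ioc_of_le hab.le] at hint
  have hN : (volume.restrict (Ioc a b))
      {x | ¬ (DifferentiableAt ℝ F x ∧ x ∈ Ioo a b)} = 0 := by
    rw [← ae_iff]
    have h1 : ∀ᵐ x ∂(volume.restrict (Ioc a b)), DifferentiableAt ℝ F x :=
      ae_restrict_of_ae hF.ae_differentiableAt
    have h2 : ∀ᵐ x ∂(volume.restrict (Ioc a b)), x ≠ b :=
      ae_restrict_of_ae (by simp [ae_iff])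
    filter_upwards [h1, h2, ae_restrict_mem measurableSet_Ioc] with x h1 h2 h3
    exact ⟨h1, h3.1, lt_of_le_of_ne h3.2 h2⟩
  obtain ⟨x, hx, hxle⟩ := exists_notMem_null_le_average
    (by rw [Ne, Measure.restrict_eq_zero]; simp [hab]) hint hN
  simp only [mem_ofPred_eq, not_not] at hx
  refine ⟨x, hx.2, hx.1, hxle.trans_lt ?_⟩
  rw [setAverage_eq, smul_eq_mul, Real.volume_real_Ioc_of_le hab.le,
    inv_mul_lt_iff₀ (by linarith)]
  linarith [hle.2]

theorem LipschitzWith.image_cthickening_subset {E E' : Type*} [PseudoEMetricSpace E]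
    [PseudoEMetricSpace E'] {f : E → E'} (hf : LipschitzWith 1 f) (h : ℝ) (A : Set E) :
    MapsTo f (Metric.cthickening h A) (Metric.cthickening h (f '' A)) := by
  intro x hx
  rw [Metric.mem_cthickening_iff] at hx ⊢
  refine le_trans ?_ hx
  rw [Metric.le_infEDist]
  intro y hy
  refine (Metric.infEDist_le_edist_of_mem (mem_image_of_mem f hy)).trans ?_
  simpa using hf x y

theorem cthickening_Iic_subset (s : ℝ) {h : ℝ} (hh : 0 ≤ h) :
    Metric.cthickening h (Iic s) ⊆ Iic (s + h) := by
  rw [isClosed_Iic.cthickening_eq_biUnion_closedBall hh]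
  intro x hx
  simp only [mem_iUnion, Metric.mem_closedBall, Real.dist_eq, mem_Iic, exists_prop] at hx ⊢
  obtain ⟨y, hy, hxy⟩ := hx
  linarith [le_abs_self (x - y)]

theorem cthickening_Ici_subset (s : ℝ) {h : ℝ} (hh : 0 ≤ h) :
    Metric.cthickening h (Ici s) ⊆ Ici (s - h) := by
  rw [isClosed_Ici.cthickening_eq_biUnion_closedBall hh]
  intro x hx
  simp only [mem_iUnion, Metric.mem_closedBall, Real.dist_eq, mem_Ici, exists_prop] at hx ⊢
  obtain ⟨y, hy, hxy⟩ := hx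
  linarith [neg_abs_le (x - y)]

theorem HasDerivAt.eventually_le_add_mul {F : ℝ → ℝ} {x F' d : ℝ} (hF : HasDerivAt F F' x)
    (hd : F' < d) : ∀ᶠ h in 𝓝[>] (0 : ℝ), F (x + h) ≤ F x + d * h := by
  have := (hF.tendsto_slope_zero_right).eventually (eventually_lt_nhds hd)
  filter_upwards [this, self_mem_nhdsWithin] with h hh hpos
  have hpos : 0 < h := hpos
  rw [smul_eq_mul, inv_mul_lt_iff₀ hpos] at hh
  linarith

theorem HasDerivAt.eventually_sub_le {F : ℝ → ℝ} {x F' d : ℝ} (hF : HasDerivAt F F' x)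
    (hd : F' < d) : ∀ᶠ h in 𝓝[>] (0 : ℝ), F x - d * h ≤ F (x - h) := by
  have h1 : HasDerivAt (fun y => - F (2 * x - y)) F' x := by
    have : HasDerivAt F F' (2 * x - x) := by convert hF using 1; ring
    have h2 := (this.comp_const_sub (2 * x) x).neg
    rw [neg_neg] at h2
    exact h2
  filter_upwards [h1.eventually_le_add_mul hd] with h hh
  have e1 : 2 * x - (x + h) = x - h := by ring
  have e2 : 2 * x - x = x := by ring
  rw [e1, e2] at hh
  linarith

theorem continuous_cdf_of_nullSingletonClass (μ : Measure ℝ) [IsProbabilityMeasure μ]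
    [NullSingletonClass μ] :
    Continuous (cdf μ) := by
  refine continuous_iff_continuousAt.2 fun x => ?_
  have h := (cdf μ).measure_singleton x
  rw [measure_cdf, measure_singleton, eq_comm, ENNReal.ofReal_eq_zero, sub_nonpos] at h
  rw [(monotone_cdf μ).continuousAt_iff_leftLim_eq_rightLim, (cdf μ).rightLim_eq]
  exact le_antisymm ((monotone_cdf μ).leftLim_le le_rfl) h

theorem measureReal_Ioc_eq_cdf_sub (μ : Measure ℝ) [IsProbabilityMeasure μ] {a b : ℝ}
    (hab : a ≤ b) : μ.real (Ioc a b) = cdf μ b - cdf μ a := by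
  rw [cdf_eq_real, cdf_eq_real, ← Iic_sdiff_Iic, measureReal_sdiff (Iic_subset_Iic.2 hab)
    measurableSet_Iic]

theorem measureReal_Ici_eq_one_sub_cdf (μ : Measure ℝ) [IsProbabilityMeasure μ]
    [NullSingletonClass μ]
    (a : ℝ) : μ.real (Ici a) = 1 - cdf μ a := by
  rw [measureReal_congr Ioi_ae_eq_Ici.symm, cdf_eq_real, ← compl_Iic,
    probReal_compl_eq_one_sub measurableSet_Iic]

/-- The distribution function of an atomless law pushes the law forward to the uniform law. -/
theorem map_cdf_eq_uniform (μ : Measure ℝ) [IsProbabilityMeasure μ] [NullSingletonClass μ] :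
    μ.map (cdf μ) = volume.restrict (Icc 0 1) := by
  have hcont := continuous_cdf_of_nullSingletonClass μ
  have : IsFiniteMeasure (μ.map (cdf μ)) := inferInstance
  refine Measure.ext_of_Iic _ _ fun u => ?_
  rw [Measure.map_apply hcont.measurable measurableSet_Iic,
    Measure.restrict_apply measurableSet_Iic]
  have hpre : cdf μ ⁻¹' Iic u = {x | cdf μ x ≤ u} := rfl
  rw [hpre]
  rcases lt_or_ge u 0 with hu | hu
  · have h1 : {x | cdf μ x ≤ u} = ∅ := by
      ext x
      simpa using hu.trans_le (cdf_nonneg μ x)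
    have h2 : Iic u ∩ Icc 0 1 = ∅ := by
      ext x
      simp only [mem_inter_iff, mem_Iic, mem_Icc, mem_empty_iff_false, iff_false]
      intro h
      linarith [h.1, h.2.1]
    rw [h1, h2]
    simp
  rcases le_or_gt 1 u with hu1 | hu1
  · have h1 : {x | cdf μ x ≤ u} = univ := by
      ext x
      simpa using (cdf_le_one μ x).trans hu1
    have h2 : Iic u ∩ Icc 0 1 = Icc (0 : ℝ) 1 := inter_eq_right.2 fun x hx => hx.2.trans hu1
    rw [h1, h2]
    simp
  have h2 : Iic u ∩ Icc 0 1 = Icc (0 : ℝ) u := by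
    ext x
    simp only [mem_inter_iff, mem_Iic, mem_Icc]
    constructor
    · exact fun h => ⟨h.2.1, h.1⟩
    · exact fun h => ⟨h.2, h.1, h.2.trans hu1.le⟩
  rw [h2, Real.volume_Icc, sub_zero]
  rcases eq_empty_or_nonempty {x | cdf μ x ≤ u} with he | hne
  · have hu0 : u = 0 := by
      by_contra hne
      have hpos : 0 < u := lt_of_le_of_ne hu (Ne.symm hne)
      obtain ⟨x, hx⟩ := ((tendsto_cdf_atBot μ).eventually (eventually_lt_nhds hpos)).exists
      have : x ∈ {x | cdf μ x ≤ u} := hx.le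
      rw [he] at this
      exact this
    rw [he, hu0]
    simp
  have hbdd : BddAbove {x | cdf μ x ≤ u} := by
    obtain ⟨y, hy⟩ := ((tendsto_cdf_atTop μ).eventually (eventually_gt_nhds hu1)).exists
    refine ⟨y, fun x hx => ?_⟩
    by_contra! hlt
    have hx : cdf μ x ≤ u := hx
    linarith [monotone_cdf μ hlt.le]
  have hclosed : IsClosed {x | cdf μ x ≤ u} := isClosed_le hcont continuous_const
  set c := sSup {x | cdf μ x ≤ u} with hc
  have hcm : cdf μ c ≤ u := hclosed.csSup_mem hne hbdd
  have hset : {x | cdf μ x ≤ u} = Iic c := by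
    ext x
    exact ⟨fun hx => le_csSup hbdd hx, fun hx => (monotone_cdf μ hx).trans hcm⟩
  have hcu : cdf μ c = u := by
    refine le_antisymm hcm ?_
    have : ∀ᶠ x in 𝓝[>] c, u ≤ cdf μ x := by
      filter_upwards [self_mem_nhdsWithin] with x hx
      by_contra! hlt
      exact absurd (le_csSup hbdd (show x ∈ {x | cdf μ x ≤ u} from hlt.le)) (not_le.2 hx)
    exact ge_of_tendsto (hcont.continuousAt.tendsto.mono_left nhdsWithin_le_nhds) this
  rw [hset, ← ofReal_cdf, hcu]

/-- Two points of a compact set of large measure whose distribution function values differ by a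
prescribed amount. -/
theorem exists_mem_cdf_eq_add (μ : Measure ℝ) [IsProbabilityMeasure μ] [NullSingletonClass μ]
    {C : Set ℝ}
    (hC : IsCompact C) (hμC : 3 / 4 < μ.real C) {p : ℝ} (hp0 : 0 ≤ p) (hp : p ≤ 1 / 2) :
    ∃ a ∈ C, ∃ b ∈ C, cdf μ b = cdf μ a + p := by
  have hcont := continuous_cdf_of_nullSingletonClass μ
  have hU : MeasurableSet (cdf μ '' C) := (hC.image hcont).measurableSet
  have hsub : cdf μ '' C ⊆ Icc 0 1 := by
    rintro _ ⟨x, -, rfl⟩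
    exact ⟨cdf_nonneg μ x, cdf_le_one μ x⟩
  have hfin : volume (cdf μ '' C) ≠ ∞ := (hC.image hcont).measure_ne_top
  have hvol : μ.real C ≤ volume.real (cdf μ '' C) := by
    refine ENNReal.toReal_mono hfin ?_
    calc μ C ≤ μ (cdf μ ⁻¹' (cdf μ '' C)) := measure_mono (subset_preimage_image _ _)
      _ = μ.map (cdf μ) (cdf μ '' C) := (Measure.map_apply hcont.measurable hU).symm
      _ ≤ volume (cdf μ '' C) := by
          rw [map_cdf_eq_uniform]
          exact Measure.restrict_apply_le _ _
  by_contra! hno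
  set U := cdf μ '' C with hUdef
  have hdisj : Disjoint U ((fun x => x + p) ⁻¹' U) := by
    rw [Set.disjoint_left]
    rintro _ ⟨a, ha, rfl⟩ ⟨b, hb, hab⟩
    exact hno a ha b hb hab
  have hV : volume.real ((fun x => x + p) ⁻¹' U) = volume.real U := by
    simp [Measure.real, measure_preimage_add_right]
  have hVfin : volume ((fun x => x + p) ⁻¹' U) ≠ ∞ := by
    rwa [measure_preimage_add_right]
  have hle : volume.real (U ∪ (fun x => x + p) ⁻¹' U) ≤ volume.real (Icc (-p) 1) := by
    refine measureReal_mono (union_subset ?_ ?_) (by simp)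
    · exact hsub.trans (Icc_subset_Icc_left (by linarith))
    · intro x hx
      have := hsub hx
      simp only [mem_Icc] at this ⊢
      constructor <;> linarith [this.1, this.2]
  rw [measureReal_union hdisj (hU.preimage (by fun_prop)) hfin hVfin, hV,
    Real.volume_real_Icc_of_le (by linarith)] at hle
  linarith

theorem exists_isCompact_deriv_cdf_le (μ : Measure ℝ) [IsProbabilityMeasure μ]
    (hac : μ ≪ volume) :
    ∃ C : Set ℝ, ∃ K : ℝ, IsCompact C ∧ 0 ≤ K ∧ 3 / 4 < μ.real C ∧
      ∀ x ∈ C, DifferentiableAt ℝ (cdf μ) x ∧ deriv (cdf μ) x ≤ K := by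
  set G : ℕ → Set ℝ := fun k => {x | DifferentiableAt ℝ (cdf μ) x} ∩ {x | deriv (cdf μ) x ≤ k}
    with hG
  have hmono : Monotone G := by
    intro i j hij x hx
    exact ⟨hx.1, le_trans (show deriv (cdf μ) x ≤ i from hx.2) (by exact_mod_cast hij)⟩
  have hmeas : ∀ k, MeasurableSet (G k) := fun k =>
    (measurableSet_of_differentiableAt ℝ (cdf μ)).inter
      (measurableSet_le (measurable_deriv _) measurable_const)
  have hU : μ (⋃ k, G k) = 1 := by
    rw [prob_compl_eq_zero_iff (MeasurableSet.iUnion hmeas) |>.symm]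
    have := hac.ae_le (monotone_cdf μ).ae_differentiableAt
    refine measure_mono_null ?_ (ae_iff.1 this)
    intro x hx hd
    refine hx ?_
    obtain ⟨k, hk⟩ := exists_nat_ge (deriv (cdf μ) x)
    exact mem_iUnion.2 ⟨k, hd, hk⟩
  have hlim := tendsto_measure_iUnion_atTop (μ := μ) hmono
  rw [hU] at hlim
  have hlt : ENNReal.ofReal (3 / 4) < 1 := by
    rw [ENNReal.ofReal_lt_one]
    norm_num
  obtain ⟨k, hk⟩ := (hlim.eventually (eventually_gt_nhds hlt)).exists
  obtain ⟨C, hCG, hC, hμC⟩ := (hmeas k).exists_lt_isCompact hk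
  refine ⟨C, k, hC, by positivity, ?_, fun x hx => hCG hx⟩
  rwa [Measure.real, ← ENNReal.ofReal_lt_iff_lt_toReal (by norm_num) (measure_ne_top _ _)]

/-- An absolutely continuous law on the line has sets of every probability whose thickenings
grow at a uniformly bounded linear rate. -/
theorem exists_measure_cthickening_le (μ : Measure ℝ) [IsProbabilityMeasure μ]
    (hac : μ ≪ volume) :
    ∃ K : ℝ, 0 ≤ K ∧ ∀ p ∈ Icc (0 : ℝ) 1, ∃ B : Set ℝ, MeasurableSet B ∧ μ.real B = p ∧
      ∀ᶠ h in 𝓝[>] (0 : ℝ), μ.real (Metric.cthickening h B) ≤ p + K * h := by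
  have : NullSingletonClass μ := ⟨fun x => hac (measure_singleton x)⟩
  obtain ⟨C, K, hC, hK, hμC, hd⟩ := exists_isCompact_deriv_cdf_le μ hac
  have hev : ∀ a ∈ C, ∀ b ∈ C, ∀ᶠ h in 𝓝[>] (0 : ℝ), 0 < h ∧
      cdf μ (a + h) ≤ cdf μ a + (K + 1) * h ∧ cdf μ b - (K + 1) * h ≤ cdf μ (b - h) := by
    intro a ha b hb
    have h1 := (hd a ha).1.hasDerivAt.eventually_le_add_mul
      (lt_of_le_of_lt (hd a ha).2 (lt_add_one K))
    have h2 := (hd b hb).1.hasDerivAt.eventually_sub_le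
      (lt_of_le_of_lt (hd b hb).2 (lt_add_one K))
    filter_upwards [self_mem_nhdsWithin, h1, h2] with h h0 h1 h2
    exact ⟨h0, h1, h2⟩
  refine ⟨2 * (K + 1), by positivity, fun p hp => ?_⟩
  rcases le_or_gt p (1 / 2) with hp2 | hp2
  · rcases eq_or_lt_of_le hp.1 with h0 | h0
    · refine ⟨∅, MeasurableSet.empty, by simp [← h0], ?_⟩
      filter_upwards [self_mem_nhdsWithin] with h hpos
      have hpos : 0 < h := hpos
      simp only [Metric.cthickening_empty, measureReal_empty, ← h0]
      positivity
    obtain ⟨a, ha, b, hb, hab⟩ := exists_mem_cdf_eq_add μ hC hμC hp.1 hp2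
    have hlt : a < b := by
      by_contra! hle
      linarith [monotone_cdf μ hle]
    refine ⟨Ioc a b, measurableSet_Ioc, by rw [measureReal_Ioc_eq_cdf_sub μ hlt.le]; linarith, ?_⟩
    filter_upwards [hev b hb a ha] with h ⟨hpos, h1, h2⟩
    have hsub : Metric.cthickening h (Ioc a b) ⊆ Icc (a - h) (b + h) := by
      intro x hx
      exact ⟨cthickening_Ici_subset a hpos.le
          (Metric.cthickening_subset_of_subset h (fun y hy => hy.1.le) hx),
        cthickening_Iic_subset b hpos.le
          (Metric.cthickening_subset_of_subset h (fun y hy => hy.2) hx)⟩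
    refine (measureReal_mono hsub).trans ?_
    rw [measureReal_congr Ioc_ae_eq_Icc.symm, measureReal_Ioc_eq_cdf_sub μ (by linarith)]
    linarith
  · obtain ⟨a, ha, b, hb, hab⟩ :=
      exists_mem_cdf_eq_add μ hC hμC (p := 1 - p) (by linarith [hp.2]) (by linarith)
    rcases eq_or_lt_of_le hp.2 with h0 | h0
    · refine ⟨univ, MeasurableSet.univ, by simp [h0], ?_⟩
      filter_upwards [self_mem_nhdsWithin] with h hpos
      have hpos : 0 < h := hpos
      refine measureReal_le_one.trans ?_
      rw [h0]
      linarith [show 0 ≤ 2 * (K + 1) * h by positivity]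
    have hlt : a < b := by
      by_contra! hle
      linarith [monotone_cdf μ hle]
    refine ⟨Iic a ∪ Ici b, measurableSet_Iic.union measurableSet_Ici, ?_, ?_⟩
    · rw [measureReal_union _ measurableSet_Ici, ← cdf_eq_real, measureReal_Ici_eq_one_sub_cdf]
      · linarith
      · rw [Set.disjoint_left]
        intro x hx hx'
        exact absurd (hx'.trans hx) (not_le.2 hlt)
    · filter_upwards [hev a ha b hb] with h ⟨hpos, h1, h2⟩
      rw [Metric.cthickening_union]
      refine (measureReal_mono (union_subset_union (cthickening_Iic_subset a hpos.le)
        (cthickening_Ici_subset b hpos.le))).trans ?_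
      refine (measureReal_union_le _ _).trans ?_
      rw [← cdf_eq_real, measureReal_Ici_eq_one_sub_cdf]
      linarith

section Staircase

variable {E : Type*} [MeasurableSpace E] {τ : Measure E} [IsProbabilityMeasure τ]
  {μ ν : Measure ℝ} [IsProbabilityMeasure ν] {S y : E → ℝ}

theorem measureReal_staircase (hS : Measurable S) (hy : Measurable y)
    (hSν : τ.map S = ν) (hyμ : τ.map y = μ) (hind : IndepFun S y τ) {a b : ℝ} (hab : a ≤ b)
    {B : Set ℝ} (hB : MeasurableSet B) :
    τ.real (S ⁻¹' Iic a ∪ (S ⁻¹' Iic b ∩ y ⁻¹' B)) =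
      cdf ν a + (cdf ν b - cdf ν a) * μ.real B := by
  have hset : S ⁻¹' Iic a ∪ (S ⁻¹' Iic b ∩ y ⁻¹' B) =
      S ⁻¹' Iic a ∪ (S ⁻¹' Ioc a b ∩ y ⁻¹' B) := by
    ext x
    simp only [mem_union, mem_inter_iff, mem_preimage, mem_Iic, mem_Ioc]
    constructor
    · rintro (h | h)
      · exact Or.inl h
      · rcases le_or_gt (S x) a with h' | h'
        · exact Or.inl h'
        · exact Or.inr ⟨⟨h', h.1⟩, h.2⟩
    · rintro (h | h)
      · exact Or.inl h
      · exact Or.inr ⟨h.1.2, h.2⟩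
  rw [hset, measureReal_union _ ((hS measurableSet_Ioc).inter (hy hB))]
  · have h1 : τ.real (S ⁻¹' Ioc a b ∩ y ⁻¹' B) = τ.real (S ⁻¹' Ioc a b) * τ.real (y ⁻¹' B) := by
      simp only [Measure.real]
      rw [hind.measure_inter_preimage_eq_mul _ _ measurableSet_Ioc hB, ENNReal.toReal_mul]
    rw [h1, ← map_measureReal_apply hS measurableSet_Ioc, ← map_measureReal_apply hy hB,
      ← map_measureReal_apply hS measurableSet_Iic, hSν, hyμ, measureReal_Ioc_eq_cdf_sub ν hab,
      cdf_eq_real ν a]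
  · rw [Set.disjoint_left]
    intro x hx hx'
    exact absurd hx'.1.1 (not_lt.2 hx)

/-- Bound on the isoperimetric function by a set interpolating between two half-spaces. -/
theorem isopFun_le_of_staircase [PseudoEMetricSpace E] [IsProbabilityMeasure μ]
    (hS : Measurable S) (hy : Measurable y)
    (hSν : τ.map S = ν) (hyμ : τ.map y = μ) (hind : IndepFun S y τ)
    (hSL : LipschitzWith 1 S) (hyL : LipschitzWith 1 y)
    {a b d K p : ℝ} (hab : a ≤ b) (hd : 0 ≤ d) (hK : 0 ≤ K)
    (hda : DifferentiableAt ℝ (cdf ν) a) (hda' : deriv (cdf ν) a < d)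
    (hdb : DifferentiableAt ℝ (cdf ν) b) (hdb' : deriv (cdf ν) b < d)
    {B : Set ℝ} (hB : MeasurableSet B) (hBp : μ.real B = p)
    (hBK : ∀ᶠ h in 𝓝[>] (0 : ℝ), μ.real (Metric.cthickening h B) ≤ p + K * h) :
    isopFun τ (cdf ν a + (cdf ν b - cdf ν a) * p) ≤
      ENNReal.ofReal (d + (cdf ν b - cdf ν a) * K) := by
  have hFab : 0 ≤ cdf ν b - cdf ν a := sub_nonneg.2 (monotone_cdf ν hab)
  set A : Set E := S ⁻¹' Iic a ∪ (S ⁻¹' Iic b ∩ y ⁻¹' B) with hA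
  have hAm : MeasurableSet A := (hS measurableSet_Iic).union ((hS measurableSet_Iic).inter (hy hB))
  have hτA : τ.real A = cdf ν a + (cdf ν b - cdf ν a) * p := by
    rw [hA, measureReal_staircase hS hy hSν hyμ hind hab hB, hBp]
  refine (isopFun_le_boundaryMeasure hAm hτA).trans (boundaryMeasure_le_ofReal (by positivity) ?_)
  filter_upwards [hda.hasDerivAt.eventually_le_add_mul hda',
    hdb.hasDerivAt.eventually_le_add_mul hdb', hBK, self_mem_nhdsWithin] with h h1 h2 h3 hpos
  have hpos : 0 < h := hpos
  have hsub : Metric.cthickening h A ⊆ S ⁻¹' Iic (a + h) ∪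
      (S ⁻¹' Iic (b + h) ∩ y ⁻¹' (Metric.cthickening h B)) := by
    have hSc : ∀ s, Metric.cthickening h (S ⁻¹' Iic s) ⊆ S ⁻¹' Iic (s + h) := fun s x hx =>
      cthickening_Iic_subset s hpos.le (Metric.cthickening_subset_of_subset h
        (image_preimage_subset _ _) (hSL.image_cthickening_subset h _ hx))
    rw [hA, Metric.cthickening_union]
    refine union_subset_union (hSc a) fun x hx => ⟨hSc b ?_, ?_⟩
    · exact Metric.cthickening_subset_of_subset h inter_subset_left hx
    · exact Metric.cthickening_subset_of_subset h (image_preimage_subset y B)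
        (hyL.image_cthickening_subset h _
          (Metric.cthickening_subset_of_subset h inter_subset_right hx))
  refine (measureReal_mono hsub).trans ?_
  rw [measureReal_staircase hS hy hSν hyμ hind (by linarith)
    Metric.isClosed_cthickening.measurableSet, hτA]
  set q := μ.real (Metric.cthickening h B)
  have hq0 : 0 ≤ q := measureReal_nonneg
  have hq1 : q ≤ 1 := measureReal_le_one
  nlinarith [mul_le_mul_of_nonneg_right h1 (sub_nonneg.2 hq1), mul_le_mul_of_nonneg_right h2 hq0,
    mul_le_mul_of_nonneg_left h3 hFab]

end Staircase

theorem HasDerivAt.eventually_sub_two_mul_lt {F : ℝ → ℝ} {a D d : ℝ} (hF : HasDerivAt F D a)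
    (hd : D < d) : ∀ᶠ h in 𝓝[>] (0 : ℝ), F (a + 2 * h) - F (a + h) < d * h := by
  have h1 := hF.tendsto_slope_zero_right
  have h2 : Tendsto (fun h : ℝ => 2 * h) (𝓝[>] 0) (𝓝[>] 0) := by
    refine tendsto_nhdsWithin_of_tendsto_nhds_of_eventually_within _ ?_ ?_
    · have : Tendsto (fun h : ℝ => 2 * h) (𝓝 0) (𝓝 (2 * 0)) := tendsto_id.const_mul 2
      rw [mul_zero] at this
      exact this.mono_left nhdsWithin_le_nhds
    · filter_upwards [self_mem_nhdsWithin] with h hh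
      exact mul_pos two_pos (show (0 : ℝ) < h from hh)
  have h3 := ((h1.comp h2).const_mul 2).sub h1
  have h4 : 2 * D - D < d := by linarith
  filter_upwards [h3.eventually (eventually_lt_nhds h4), self_mem_nhdsWithin] with h hh hpos
  have hpos : 0 < h := hpos
  simp only [Function.comp_apply, smul_eq_mul] at hh
  have e : 2 * ((2 * h)⁻¹ * (F (a + 2 * h) - F a)) - h⁻¹ * (F (a + h) - F a) =
      h⁻¹ * (F (a + 2 * h) - F (a + h)) := by
    field_simp
    ring
  rw [e, inv_mul_lt_iff₀ hpos] at hh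
  linarith

theorem HasDerivAt.eventually_sub_sub_two_mul_lt {F : ℝ → ℝ} {a D d : ℝ} (hF : HasDerivAt F D a)
    (hd : D < d) : ∀ᶠ h in 𝓝[>] (0 : ℝ), F (a - h) - F (a - 2 * h) < d * h := by
  have h1 : HasDerivAt (fun y => - F (2 * a - y)) D a := by
    have : HasDerivAt F D (2 * a - a) := by convert hF using 1; ring
    have h2 := (this.comp_const_sub (2 * a) a).neg
    rw [neg_neg] at h2
    exact h2
  filter_upwards [h1.eventually_sub_two_mul_lt hd] with h hh
  have e1 : 2 * a - (a + 2 * h) = a - 2 * h := by ring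
  have e2 : 2 * a - (a + h) = a - h := by ring
  rw [e1, e2] at hh
  linarith

/-- If one-Lipschitz functions `S n` converge in law, and independent coordinates are available,
then the infimum of the isoperimetric functions is at most the limiting density. -/
theorem iInf_isopFun_le_of_tendsto_cdf {E : ℕ → Type*} [∀ n, MeasurableSpace (E n)]
    [∀ n, PseudoEMetricSpace (E n)] (τ : ∀ n, Measure (E n)) [∀ n, IsProbabilityMeasure (τ n)]
    {μ : Measure ℝ} [IsProbabilityMeasure μ] (hac : μ ≪ volume) {S y : ∀ n, E n → ℝ}
    (hS : ∀ n, Measurable (S n)) (hy : ∀ n, Measurable (y n))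
    (hyμ : ∀ n, (τ n).map (y n) = μ) (hind : ∀ n, IndepFun (S n) (y n) (τ n))
    (hSL : ∀ n, LipschitzWith 1 (S n)) (hyL : ∀ n, LipschitzWith 1 (y n))
    {F : ℝ → ℝ} (hF : StrictMono F) (hlim : ∀ x, Tendsto (fun n => cdf ((τ n).map (S n)) x) atTop
      (𝓝 (F x))) {a D : ℝ} (hFa : HasDerivAt F D a) :
    ⨅ n, isopFun (τ n) (F a) ≤ ENNReal.ofReal D := by
  have hD : 0 ≤ D := by
    rw [← hFa.deriv]
    exact hF.monotone.deriv_nonneg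
  obtain ⟨K, hK, hB⟩ := exists_measure_cthickening_le μ hac
  refine ENNReal.le_of_forall_pos_le_add fun ε hε _ => ?_
  set e : ℝ := ε / 2 with he
  have he0 : 0 < e := by
    have : (0 : ℝ) < ε := hε
    positivity
  have hc1 : Tendsto (fun h : ℝ => (F (a + 2 * h) - F (a - 2 * h)) * K) (𝓝[>] 0) (𝓝 0) := by
    have : ContinuousAt (fun h : ℝ => (F (a + 2 * h) - F (a - 2 * h)) * K) 0 := by
      have hc := hFa.continuousAt
      refine (ContinuousAt.sub (ContinuousAt.comp ?_ ?_) (ContinuousAt.comp ?_ ?_)).mul_const K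
      · simpa using hc
      · fun_prop
      · simpa using hc
      · fun_prop
    have h0 := this.tendsto
    simp only [mul_zero, add_zero, sub_zero, sub_self, zero_mul] at h0
    exact h0.mono_left nhdsWithin_le_nhds
  obtain ⟨δ, ⟨⟨h1, h2⟩, h3⟩, hδ⟩ :=
    (((hFa.eventually_sub_two_mul_lt (lt_add_of_pos_right D he0)).and
    (hFa.eventually_sub_sub_two_mul_lt (lt_add_of_pos_right D he0))).and
    (hc1.eventually (eventually_lt_nhds he0)) |>.and self_mem_nhdsWithin).exists
  have hδ : 0 < δ := hδ
  have hpr : ∀ n, IsProbabilityMeasure ((τ n).map (S n)) := fun n =>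
    Measure.isProbabilityMeasure_map (hS n).aemeasurable
  have hn : ∀ᶠ n in atTop,
      (cdf ((τ n).map (S n)) (a + 2 * δ) - cdf ((τ n).map (S n)) (a + δ) < (D + e) * δ ∧
      cdf ((τ n).map (S n)) (a - δ) - cdf ((τ n).map (S n)) (a - 2 * δ) < (D + e) * δ) ∧
      (cdf ((τ n).map (S n)) (a + 2 * δ) - cdf ((τ n).map (S n)) (a - 2 * δ)) * K < e ∧
      cdf ((τ n).map (S n)) (a - δ) < F a ∧ F a < cdf ((τ n).map (S n)) (a + δ) :=
    ((((hlim _).sub (hlim _)).eventually (eventually_lt_nhds h1)).and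
      (((hlim _).sub (hlim _)).eventually (eventually_lt_nhds h2))).and
      (((((hlim _).sub (hlim _)).mul_const K).eventually (eventually_lt_nhds h3)).and
      (((hlim _).eventually (eventually_lt_nhds (hF (by linarith)))).and
      ((hlim _).eventually (eventually_gt_nhds (hF (by linarith))))))
  obtain ⟨n, ⟨hn1, hn2⟩, hn3, hn4, hn5⟩ := hn.exists
  refine (iInf_le _ n).trans ?_
  set ν := (τ n).map (S n) with hν
  have hm := monotone_cdf ν
  obtain ⟨s₁, hs₁, hd₁, hd₁'⟩ := hm.exists_mem_Ioo_deriv_lt (a := a + δ) (b := a + 2 * δ)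
    (d := D + e) (by linarith) (by linarith)
  obtain ⟨s₂, hs₂, hd₂, hd₂'⟩ := hm.exists_mem_Ioo_deriv_lt (a := a - 2 * δ) (b := a - δ)
    (d := D + e) (by linarith) (by linarith)
  have hlt₁ : F a < cdf ν s₁ := hn5.trans_le (hm hs₁.1.le)
  have hlt₂ : cdf ν s₂ < F a := (hm hs₂.2.le).trans_lt hn4
  have hpos : 0 < cdf ν s₁ - cdf ν s₂ := by linarith
  set p := (F a - cdf ν s₂) / (cdf ν s₁ - cdf ν s₂) with hp
  have hpI : p ∈ Icc (0 : ℝ) 1 :=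
    ⟨div_nonneg (by linarith) hpos.le, (div_le_one hpos).2 (by linarith)⟩
  obtain ⟨B, hBm, hBp, hBK⟩ := hB p hpI
  have hfin := isopFun_le_of_staircase (hS n) (hy n) hν.symm (hyμ n) (hind n) (hSL n) (hyL n)
    (show s₂ ≤ s₁ by linarith [hs₁.1, hs₂.2]) (by positivity) hK hd₂ hd₂' hd₁ hd₁' hBm hBp hBK
  have hval : cdf ν s₂ + (cdf ν s₁ - cdf ν s₂) * p = F a := by
    rw [hp, mul_div_cancel₀ _ hpos.ne']
    ring
  rw [hval] at hfin
  refine hfin.trans ?_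
  rw [← ENNReal.ofReal_coe_nnreal, ← ENNReal.ofReal_add hD ε.coe_nonneg]
  refine ENNReal.ofReal_le_ofReal ?_
  have h4 : (cdf ν s₁ - cdf ν s₂) * K ≤ (cdf ν (a + 2 * δ) - cdf ν (a - 2 * δ)) * K :=
    mul_le_mul_of_nonneg_right (sub_le_sub (hm hs₁.2.le) (hm hs₂.1.le)) hK
  linarith

theorem lintegral_pi_fin_prod (n : ℕ) {f : Fin n → ℝ → ℝ≥0∞} (hf : ∀ i, Measurable (f i)) :
    ∫⁻ x : Fin n → ℝ, ∏ i, f i (x i) = ∏ i, ∫⁻ x, f i x := by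
  induction n with
  | zero => simp [volume_pi]
  | succ n ih =>
    have hmp := (volume_preserving_piFinSuccAbove (fun _ : Fin (n + 1) => ℝ) 0).symm
    have hm : Measurable fun x : Fin (n + 1) → ℝ => ∏ i, f i (x i) :=
      Finset.measurable_prod _ fun i _ => (hf i).comp (measurable_pi_apply i)
    rw [← hmp.lintegral_comp hm]
    simp only [MeasurableEquiv.piFinSuccAbove_symm_apply, Fin.prod_univ_succ,
      Fin.insertNthEquiv_zero, Fin.consEquiv_apply, Fin.cons_zero, Fin.cons_succ]
    rw [Measure.volume_eq_prod, lintegral_prod_mul (f := f 0)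
      (g := fun y : Fin n → ℝ => ∏ i, f i.succ (y i)) (hf 0).aemeasurable
      (Finset.measurable_prod _ fun i _ =>
        (hf i.succ).comp (measurable_pi_apply i)).aemeasurable, ih fun i => hf i.succ]

/-- The product density on Euclidean space is the density of the product measure. -/
theorem withDensity_prod_eq_map_pi {n : ℕ} {g : ℝ → ℝ≥0∞} (hg : Measurable g)
    [IsProbabilityMeasure (volume.withDensity g)] :
    volume.withDensity (fun x : EuclideanSpace ℝ (Fin n) => ∏ i, g (x i)) =
      (Measure.pi fun _ : Fin n => volume.withDensity g).map (WithLp.toLp 2) := by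
  have hG : Measurable fun x : Fin n → ℝ => ∏ i, g (x i) :=
    Finset.measurable_prod _ fun i _ => hg.comp (measurable_pi_apply i)
  have hpi : (Measure.pi fun _ : Fin n => volume.withDensity g) =
      volume.withDensity fun x : Fin n → ℝ => ∏ i, g (x i) := by
    refine Measure.pi_eq fun s hs => ?_
    rw [withDensity_apply _ (MeasurableSet.univ_pi hs),
      ← lintegral_indicator (MeasurableSet.univ_pi hs)]
    have hind : ((univ.pi s).indicator fun x : Fin n → ℝ => ∏ i, g (x i)) =
        fun x => ∏ i, (s i).indicator g (x i) := by
      ext x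
      by_cases hx : x ∈ univ.pi s
      · rw [indicator_of_mem hx]
        exact Finset.prod_congr rfl fun i _ => (indicator_of_mem (hx i (mem_univ i)) g).symm
      · rw [indicator_of_notMem hx]
        simp only [mem_univ_pi, not_forall] at hx
        obtain ⟨i, hi⟩ := hx
        exact (Finset.prod_eq_zero (Finset.mem_univ i) (indicator_of_notMem hi g)).symm
    rw [hind, lintegral_pi_fin_prod n fun i => hg.indicator (hs i)]
    refine Finset.prod_congr rfl fun i _ => ?_
    rw [lintegral_indicator (hs i), withDensity_apply _ (hs i)]
  rw [hpi]
  have hmp := PiLp.volume_preserving_toLp (Fin n)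
  ext s hs
  rw [Measure.map_apply hmp.measurable hs, withDensity_apply _ hs,
    withDensity_apply _ (hmp.measurable hs), ← hmp.setLIntegral_comp_preimage hs]
  exact hG.comp (by fun_prop)

/-- Initial segment of a sequence, as a point of Euclidean space. -/
noncomputable def euclideanTruncation (n : ℕ) (ω : ℕ → ℝ) : EuclideanSpace ℝ (Fin n) :=
  WithLp.toLp 2 fun i => ω i

theorem measurable_euclideanTruncation (n : ℕ) : Measurable (euclideanTruncation n) :=
  (WithLp.measurable_toLp 2 _).comp (measurable_pi_lambda _ fun _ => measurable_pi_apply _)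

theorem map_euclideanTruncation (n : ℕ) {g : ℝ → ℝ≥0∞} (hg : Measurable g)
    [IsProbabilityMeasure (volume.withDensity g)] :
    (Measure.infinitePi fun _ : ℕ => volume.withDensity g).map (euclideanTruncation n) =
      volume.withDensity (fun x : EuclideanSpace ℝ (Fin n) => ∏ i, g (x i)) := by
  rw [withDensity_prod_eq_map_pi hg, ← Measure.infinitePi_eq_pi,
    ← Measure.map_infinitePi_infinitePi_of_inj (P := fun _ : ℕ => volume.withDensity g)
      (Fin.val_injective (n := n))]
  exact (Measure.map_map (WithLp.measurable_toLp 2 _)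
    (measurable_pi_lambda _ fun _ => measurable_pi_apply _)).symm

/-- Centered sum of all coordinates but the last, normalized to be one-Lipschitz. -/
noncomputable def normalizedSum (m : ℝ) (n : ℕ) (x : EuclideanSpace ℝ (Fin (n + 1))) : ℝ :=
  (√n)⁻¹ * (∑ k : Fin n, x k.castSucc - n * m)

theorem lipschitzWith_normalizedSum (m : ℝ) (n : ℕ) : LipschitzWith 1 (normalizedSum m n) := by
  refine LipschitzWith.of_dist_le_mul fun x y => ?_
  rw [NNReal.coe_one, one_mul, Real.dist_eq]
  have h1 : normalizedSum m n x - normalizedSum m n y =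
      (√n)⁻¹ * ∑ k : Fin n, (x k.castSucc - y k.castSucc) := by
    rw [normalizedSum, normalizedSum, Finset.sum_sub_distrib]
    ring
  have h2 : (∑ k : Fin n, (x k.castSucc - y k.castSucc)) ^ 2 ≤ n * dist x y ^ 2 := by
    have h3 := sq_sum_le_card_mul_sum_sq (s := Finset.univ)
      (f := fun k : Fin n => x k.castSucc - y k.castSucc)
    rw [Finset.card_univ, Fintype.card_fin] at h3
    refine h3.trans (mul_le_mul_of_nonneg_left ?_ (by positivity))
    rw [EuclideanSpace.dist_eq, Real.sq_sqrt (by positivity), Fin.sum_univ_castSucc]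
    simp only [Real.dist_eq, sq_abs]
    exact le_add_of_nonneg_right (sq_nonneg _)
  rw [h1, abs_mul, abs_of_nonneg (show (0 : ℝ) ≤ (√(n : ℝ))⁻¹ by positivity)]
  rcases Nat.eq_zero_or_pos n with rfl | hn
  · simp
  have hs : 0 < √(n : ℝ) := Real.sqrt_pos.2 (by exact_mod_cast hn)
  rw [inv_mul_le_iff₀ hs]
  refine abs_le_of_sq_le_sq (b := √n * dist x y) ?_ (by positivity)
  rwa [mul_pow, Real.sq_sqrt (Nat.cast_nonneg n)]

theorem lipschitzWith_eval_last (n : ℕ) :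
    LipschitzWith 1 fun x : EuclideanSpace ℝ (Fin (n + 1)) => x (Fin.last n) := by
  refine LipschitzWith.of_dist_le_mul fun x y => ?_
  rw [NNReal.coe_one, one_mul]
  exact PiLp.dist_apply_le x y _

theorem normalizedSum_euclideanTruncation (m : ℝ) (n : ℕ) (ω : ℕ → ℝ) :
    normalizedSum m n (euclideanTruncation (n + 1) ω) =
      (√n)⁻¹ * (∑ k ∈ Finset.range n, ω k - n * m) := by
  rw [normalizedSum, Finset.sum_range]
  rfl

theorem indepFun_normalizedSum_last (m : ℝ) (n : ℕ) (μ : Measure ℝ) [IsProbabilityMeasure μ] :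
    IndepFun (fun ω : ℕ → ℝ => normalizedSum m n (euclideanTruncation (n + 1) ω))
      (fun ω => ω n) (Measure.infinitePi fun _ : ℕ => μ) := by
  have hi : iIndepFun (fun (i : ℕ) (ω : ℕ → ℝ) => ω i) (Measure.infinitePi fun _ : ℕ => μ) :=
    iIndepFun_infinitePi (P := fun _ : ℕ => μ) (X := fun _ x => x) fun _ => measurable_id
  have h := (hi.indepFun_finsetSum_of_notMem (fun i => measurable_pi_apply i)
    (s := Finset.range n) (i := n) (by simp)).comp
      (φ := fun s => (√n)⁻¹ * (s - n * m)) (ψ := id) (by fun_prop) measurable_id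
  convert h using 1
  · ext ω
    simp [normalizedSum_euclideanTruncation]
  · rfl

theorem tendsto_cdf_normalizedSum (μ : Measure ℝ) [IsProbabilityMeasure μ]
    (hL2 : MemLp (fun x => x) 2 μ) (hv : Var[fun x => x; μ] ≠ 0) (x : ℝ) :
    Tendsto (fun n => cdf ((Measure.infinitePi fun _ : ℕ => μ).map
        fun ω => normalizedSum (∫ x, x ∂μ) n (euclideanTruncation (n + 1) ω)) x) atTop
      (𝓝 (cdf (gaussianReal 0 Var[fun x => x; μ].toNNReal) x)) := by
  set P := Measure.infinitePi fun _ : ℕ => μ with hP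
  set X : ℕ → (ℕ → ℝ) → ℝ := fun i ω => ω i with hX
  have hXm : ∀ i, Measurable (X i) := fun i => measurable_pi_apply i
  have hi : iIndepFun X P :=
    iIndepFun_infinitePi (P := fun _ : ℕ => μ) (X := fun _ x => x) fun _ => measurable_id
  have hmap : ∀ i, P.map (X i) = μ := fun i => Measure.infinitePi_map_eval (fun _ : ℕ => μ) i
  have hid : ∀ i, IdentDistrib (X i) (X 0) P P := fun i =>
    ⟨(hXm i).aemeasurable, (hXm 0).aemeasurable, by rw [hmap, hmap]⟩
  have hid0 : IdentDistrib (X 0) (fun x => x) P μ :=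
    ⟨(hXm 0).aemeasurable, aemeasurable_id, by rw [hmap]; exact Measure.map_id.symm⟩
  have hvar : Var[X 0; P] = Var[fun x => x; μ] := hid0.variance_eq
  have hmean : P[X 0] = ∫ x, x ∂μ := hid0.integral_eq
  have hclt := tendstoInDistribution_inv_sqrt_mul_sum_sub (P := P) (X := X) (Y := fun x : ℝ => x)
    (P' := gaussianReal 0 Var[X 0; P].toNNReal) ⟨aemeasurable_id, Measure.map_id⟩
    (hid0.memLp_iff.2 hL2) hi hid
  have hne : Var[fun x => x; μ].toNNReal ≠ 0 := by
    simpa using lt_of_le_of_ne (variance_nonneg _ _) hv.symm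
  have hfr : gaussianReal 0 Var[X 0; P].toNNReal (frontier (Iic x)) = 0 := by
    have := nullSingletonClass_gaussianReal (μ := 0) (hvar ▸ hne : Var[X 0; P].toNNReal ≠ 0)
    rw [frontier_Iic]
    exact measure_singleton x
  have h := ProbabilityMeasure.tendsto_measure_of_null_frontier_of_tendsto' hclt.tendsto
    (E := Iic x) (by simpa using hfr)
  have h2 := (ENNReal.tendsto_toReal (measure_ne_top (gaussianReal 0 Var[X 0; P].toNNReal)
    (Iic x))).comp (by simpa [Measure.map_id'] using h)
  have hprob : ∀ n, IsProbabilityMeasure (P.map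
      fun ω => normalizedSum (∫ x, x ∂μ) n (euclideanTruncation (n + 1) ω)) := fun n =>
    Measure.isProbabilityMeasure_map ((lipschitzWith_normalizedSum _ n).continuous.measurable.comp
      (measurable_euclideanTruncation (n + 1))).aemeasurable
  rw [hmean, hvar] at h2
  rw [cdf_eq_real]
  refine h2.congr fun n => ?_
  rw [cdf_eq_real]
  simp only [normalizedSum_euclideanTruncation]
  rfl

local notation "φ₁" => gaussianPDFReal 0 1
local notation "γ₁" => gaussianReal 0 1

theorem hasDerivAt_cdf_gaussianReal (x : ℝ) : HasDerivAt (cdf γ₁) (φ₁ x) x := by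
  have hint := integrable_gaussianPDFReal 0 1
  have hF : ∀ y, cdf γ₁ y = cdf γ₁ 0 + ∫ z in (0 : ℝ)..y, φ₁ z := fun y => by
    have h : ∀ a, cdf γ₁ a = ∫ z in Iic a, φ₁ z := fun a => by
      rw [cdf_eq_real, measureReal_def, gaussianReal_apply_eq_integral _ one_ne_zero,
        ENNReal.toReal_ofReal (integral_nonneg fun z => gaussianPDFReal_nonneg 0 1 z)]
    rw [h, h, ← intervalIntegral.integral_Iic_sub_Iic hint.integrableOn hint.integrableOn]
    ring
  have hc : Continuous φ₁ := by
    rw [gaussianPDFReal_def]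
    fun_prop
  rw [funext hF]
  exact (intervalIntegral.integral_hasDerivAt_right hint.intervalIntegrable
    (hc.stronglyMeasurableAtFilter _ _) hc.continuousAt).const_add _

theorem continuous_gaussianPDFReal_zero_one : Continuous φ₁ := by
  rw [gaussianPDFReal_def]
  fun_prop

theorem gaussianPDFReal_zero_one_abs (x : ℝ) : φ₁ |x| = φ₁ x := by
  simp [gaussianPDFReal]

theorem gaussianPDFReal_zero_one_neg (x : ℝ) : φ₁ (-x) = φ₁ x := by
  simp [gaussianPDFReal]

theorem gaussianPDFReal_zero_one_le {x y : ℝ} (h : |x| ≤ |y|) : φ₁ y ≤ φ₁ x := by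
  simp only [gaussianPDFReal]
  have := sq_le_sq.2 h
  refine mul_le_mul_of_nonneg_left (Real.exp_le_exp.2 ?_) (by positivity)
  simp only [sub_zero, NNReal.coe_one]
  linarith

theorem measureReal_gaussianReal_neg (A : Set ℝ) : (γ₁).real (Neg.neg ⁻¹' A) = (γ₁).real A := by
  have h : (γ₁).map Neg.neg = γ₁ := by simpa using gaussianReal_map_neg (μ := 0) (v := 1)
  conv_rhs => rw [← h]
  exact congrArg ENNReal.toReal ((MeasurableEquiv.neg ℝ).map_apply A).symm

/-- The Gaussian hazard rate is increasing. -/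
theorem cdf_gaussianReal_neg_mul_le {r x : ℝ} (hx : r ≤ x) :
    cdf γ₁ (-x) * φ₁ r ≤ cdf γ₁ (-r) * φ₁ x := by
  have h0 : cdf γ₁ (-r) = ∫ z in Iic (-r), φ₁ z := by
    rw [cdf_eq_real, measureReal_def, gaussianReal_apply_eq_integral _ one_ne_zero,
      ENNReal.toReal_ofReal (integral_nonneg fun z => gaussianPDFReal_nonneg 0 1 z)]
  have h1 : cdf γ₁ (-x) = ∫ z in Iic (-r), gaussianPDFReal (x - r) 1 z := by
    have h := gaussianReal_map_add_const (μ := 0) (v := 1) (x - r)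
    rw [zero_add] at h
    have h2 : (gaussianReal (x - r) 1) (Iic (-r)) = γ₁ (Iic (-x)) := by
      rw [← h, Measure.map_apply (by fun_prop) measurableSet_Iic]
      congr 1
      ext z
      simp only [mem_preimage, mem_Iic]
      constructor <;> intro <;> linarith
    rw [cdf_eq_real, measureReal_def, ← h2, gaussianReal_apply_eq_integral _ one_ne_zero,
      ENNReal.toReal_ofReal (integral_nonneg fun z => gaussianPDFReal_nonneg _ 1 z)]
  rw [h0, h1, ← integral_mul_const, ← integral_mul_const]
  refine setIntegral_mono_on ((integrable_gaussianPDFReal _ 1).integrableOn.mul_const _)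
    ((integrable_gaussianPDFReal _ 1).integrableOn.mul_const _) measurableSet_Iic fun z hz => ?_
  have hz : z ≤ -r := hz
  simp only [gaussianPDFReal]
  rw [mul_mul_mul_comm, mul_mul_mul_comm _ (rexp _), ← Real.exp_add, ← Real.exp_add]
  refine mul_le_mul_of_nonneg_left (Real.exp_le_exp.2 ?_) (by positivity)
  simp only [sub_zero, NNReal.coe_one]
  nlinarith [mul_nonneg (sub_nonneg.2 hx) (sub_nonneg.2 hz)]

/-- Eventually disjoint patches of size `C * h` inside the thickening of `A`. -/
def HasBoundaryPatch (τ : Measure ℝ) (A : Set ℝ) (B : ℝ → Set ℝ) (C : ℝ) : Prop :=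
  ∀ ε > 0, ∀ᶠ h in 𝓝[>] (0 : ℝ), MeasurableSet (B h) ∧ B h ⊆ Metric.cthickening h A ∧
    Disjoint A (B h) ∧ (C - ε) * h ≤ τ.real (B h)

theorem HasBoundaryPatch.union {τ : Measure ℝ} [IsFiniteMeasure τ] {A : Set ℝ}
    {B B' : ℝ → Set ℝ} {C C' : ℝ} (h : HasBoundaryPatch τ A B C)
    (h' : HasBoundaryPatch τ A B' C') (hd : ∀ᶠ h in 𝓝[>] (0 : ℝ), Disjoint (B h) (B' h)) :
    HasBoundaryPatch τ A (fun h => B h ∪ B' h) (C + C') := by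
  intro ε hε
  filter_upwards [h (ε / 2) (by positivity), h' (ε / 2) (by positivity), hd] with h h1 h2 h3
  refine ⟨h1.1.union h2.1, union_subset h1.2.1 h2.2.1, h1.2.2.1.union_right h2.2.2.1, ?_⟩
  rw [measureReal_union h3 h2.1]
  linarith [h1.2.2.2, h2.2.2.2]

theorem HasBoundaryPatch.ofReal_le {τ : Measure ℝ} [IsFiniteMeasure τ] {A : Set ℝ}
    {B : ℝ → Set ℝ} {C : ℝ} (h : HasBoundaryPatch τ A B C) :
    ENNReal.ofReal C ≤ boundaryMeasure τ A := by
  refine ofReal_le_boundaryMeasure fun ε hε => ?_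
  filter_upwards [h ε hε] with h h1
  calc τ.real A + (C - ε) * h ≤ τ.real A + τ.real (B h) := by linarith [h1.2.2.2]
    _ = τ.real (A ∪ B h) := (measureReal_union h1.2.2.1 h1.1).symm
    _ ≤ _ := measureReal_mono (union_subset (Metric.self_subset_cthickening A) h1.2.1)

/-- `c` belongs to `A` and the points immediately to its right do not. -/
def IsRightEnd (A : Set ℝ) (c : ℝ) : Prop := c ∈ A ∧ ∃ z > c, ∀ x ∈ Ioc c z, x ∉ A

theorem HasDerivAt.eventually_mul_le_sub {F : ℝ → ℝ} {a D d : ℝ} (hF : HasDerivAt F D a)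
    (hd : d < D) : ∀ᶠ h in 𝓝[>] (0 : ℝ), d * h ≤ F (a + h) - F a := by
  filter_upwards [hF.tendsto_slope_zero_right.eventually (eventually_gt_nhds hd),
    self_mem_nhdsWithin] with h hh hpos
  have hpos : 0 < h := hpos
  rw [smul_eq_mul, lt_inv_mul_iff₀ hpos] at hh
  linarith

theorem IsRightEnd.hasBoundaryPatch {A : Set ℝ} {c : ℝ} (hc : IsRightEnd A c) :
    HasBoundaryPatch γ₁ A (fun h => Ioc c (c + h)) (φ₁ c) := by
  intro ε hε
  obtain ⟨hcA, z, hz, hzA⟩ := hc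
  filter_upwards [(hasDerivAt_cdf_gaussianReal c).eventually_mul_le_sub (sub_lt_self _ hε),
    Ioo_mem_nhdsGT (sub_pos.2 hz)] with h hh hpos
  refine ⟨measurableSet_Ioc, fun x hx => ?_, ?_, ?_⟩
  · refine Metric.mem_cthickening_of_dist_le x c _ _ hcA ?_
    rw [Real.dist_eq, abs_of_nonneg (by linarith [hx.1])]
    linarith [hx.2]
  · exact disjoint_left.2 fun x hxA hx => hzA x ⟨hx.1, by linarith [hx.2, hpos.2]⟩ hxA
  · rwa [measureReal_Ioc_eq_cdf_sub _ (by linarith [hpos.1])]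

theorem HasBoundaryPatch.of_neg {A : Set ℝ} {B : ℝ → Set ℝ} {C : ℝ}
    (h : HasBoundaryPatch γ₁ (Neg.neg ⁻¹' A) B C) :
    HasBoundaryPatch γ₁ A (fun h => Neg.neg ⁻¹' B h) C := by
  intro ε hε
  filter_upwards [h ε hε] with h h1
  refine ⟨measurable_neg h1.1, fun x hx => ?_, ?_, ?_⟩
  · have h2 := h1.2.1 hx
    rw [Metric.mem_cthickening_iff] at h2 ⊢
    convert h2 using 1
    have := Metric.infEDist_image (isometry_neg (G := ℝ)) (x := x) (t := A)
    rw [← this]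
    congr 1
    simp
  · exact disjoint_left.2 fun x hxA hx => disjoint_left.1 h1.2.2.1
      (show -x ∈ Neg.neg ⁻¹' A by simpa using hxA) hx
  · rw [measureReal_gaussianReal_neg]
    exact h1.2.2.2

theorem IsRightEnd.ofReal_add_le {A : Set ℝ} {c d : ℝ} (hc : IsRightEnd A c)
    (hd : IsRightEnd (Neg.neg ⁻¹' A) d) :
    ENNReal.ofReal (φ₁ c + φ₁ d) ≤ boundaryMeasure γ₁ A := by
  refine (hc.hasBoundaryPatch.union hd.hasBoundaryPatch.of_neg ?_).ofReal_le
  rcases lt_or_ge c (-d) with h | h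
  · filter_upwards [Ioo_mem_nhdsGT (show 0 < (-d - c) / 2 by linarith)] with e he
    refine disjoint_left.2 fun x hx hx' => ?_
    have hx' : -x ∈ Ioc d (d + e) := hx'
    linarith [hx.2, hx'.2, he.2]
  · refine Eventually.of_forall fun e => disjoint_left.2 fun x hx hx' => ?_
    have hx' : -x ∈ Ioc d (d + e) := hx'
    linarith [hx.1, hx'.1]

/-- Right endpoints of `A` pay for the fraction `α / m` of the Gaussian density at `r`. -/
def RightEndsBound (A : Set ℝ) (r m α : ℝ) : Prop :=
  α ≤ 0 ∨ ∀ ε > 0, ∃ c, IsRightEnd A c ∧ α * φ₁ r ≤ m * (φ₁ c + ε)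

theorem RightEndsBound.mono {A : Set ℝ} {r m α β : ℝ} (h : RightEndsBound A r m β) (hαβ : α ≤ β) :
    RightEndsBound A r m α := by
  rcases h with h | h
  · exact Or.inl (hαβ.trans h)
  · refine Or.inr fun ε hε => ?_
    obtain ⟨c, hc, h⟩ := h ε hε
    exact ⟨c, hc, (mul_le_mul_of_nonneg_right hαβ (gaussianPDFReal_nonneg 0 1 r)).trans h⟩

theorem RightEndsBound.ofReal_le {A : Set ℝ} {r m α β : ℝ} (hm : 0 < m)
    (hα : RightEndsBound A r m α) (hβ : RightEndsBound (Neg.neg ⁻¹' A) r m β) (h : m ≤ α + β) :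
    ENNReal.ofReal (φ₁ r) ≤ boundaryMeasure γ₁ A := by
  have hr := gaussianPDFReal_nonneg 0 1 r
  rcases eq_or_ne (boundaryMeasure γ₁ A) ∞ with htop | htop
  · rw [htop]
    exact le_top
  refine (ENNReal.ofReal_le_iff_le_toReal htop).2 (le_of_forall_pos_le_add fun ε hε => ?_)
  have hle : ∀ x, ENNReal.ofReal x ≤ boundaryMeasure γ₁ A →
      x ≤ (boundaryMeasure γ₁ A).toReal :=
    fun x hx => (ENNReal.ofReal_le_iff_le_toReal htop).1 hx
  have hmr : m * φ₁ r ≤ (α + β) * φ₁ r := mul_le_mul_of_nonneg_right h hr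
  refine le_of_mul_le_mul_left ?_ hm
  rcases hα with hα | hα
  · have h2 : m ≤ β := by linarith
    obtain ⟨d, hd, hdβ⟩ := (hβ.resolve_left (by linarith)) ε hε
    have h1 := hle _ hd.hasBoundaryPatch.of_neg.ofReal_le
    nlinarith [mul_le_mul_of_nonneg_right h2 hr, mul_le_mul_of_nonneg_left h1 hm.le]
  · rcases hβ with hβ | hβ
    · have h2 : m ≤ α := by linarith
      obtain ⟨c, hc, hcα⟩ := hα ε hε
      have h1 := hle _ hc.hasBoundaryPatch.ofReal_le
      nlinarith [mul_le_mul_of_nonneg_right h2 hr, mul_le_mul_of_nonneg_left h1 hm.le]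
    · obtain ⟨c, hc, hcα⟩ := hα (ε / 2) (by positivity)
      obtain ⟨d, hd, hdβ⟩ := hβ (ε / 2) (by positivity)
      have h1 := hle _ (hc.ofReal_add_le hd)
      nlinarith [mul_le_mul_of_nonneg_left h1 hm.le]

theorem isRightEnd_sSup {A : Set ℝ} (hA : IsClosed A) {z : ℝ} (hz : z ∉ A)
    (hne : (A ∩ Iic z).Nonempty) :
    IsRightEnd A (sSup (A ∩ Iic z)) ∧ sSup (A ∩ Iic z) < z := by
  have hbdd : BddAbove (A ∩ Iic z) := ⟨z, fun x hx => hx.2⟩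
  have hmem := (hA.inter isClosed_Iic).csSup_mem hne hbdd
  have hlt : sSup (A ∩ Iic z) < z :=
    lt_of_le_of_ne hmem.2 fun h => hz (h ▸ hmem.1)
  exact ⟨⟨hmem.1, z, hlt, fun x hx hxA =>
    hx.1.not_ge (le_csSup hbdd ⟨hxA, hx.2⟩)⟩, hlt⟩

theorem rightEndsBound_inter_Iic {A : Set ℝ} (hA : IsClosed A) {r z : ℝ} (hz : z ∉ A)
    (hzr : |z| ≤ r) :
    RightEndsBound A r (cdf γ₁ (-r)) (min ((γ₁).real (A ∩ Iic z)) (cdf γ₁ (-r))) := by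
  have hm : 0 ≤ cdf γ₁ (-r) := cdf_nonneg _ _
  rcases (A ∩ Iic z).eq_empty_or_nonempty with h | h
  · left
    rw [h]
    simp
  right
  intro ε hε
  obtain ⟨hc, hcz⟩ := isRightEnd_sSup hA hz h
  set c := sSup (A ∩ Iic z)
  refine ⟨c, hc, ?_⟩
  have hr := gaussianPDFReal_nonneg 0 1 r
  rcases le_or_gt (-r) c with h1 | h1
  · have h2 : φ₁ r ≤ φ₁ c := gaussianPDFReal_zero_one_le
      ((abs_le.2 ⟨h1, hcz.le.trans (le_of_abs_le hzr)⟩).trans (le_abs_self r))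
    calc _ ≤ cdf γ₁ (-r) * φ₁ r := mul_le_mul_of_nonneg_right (min_le_right _ _) hr
      _ ≤ _ := mul_le_mul_of_nonneg_left (by linarith) hm
  · have h2 : (γ₁).real (A ∩ Iic z) ≤ cdf γ₁ (- -c) := by
      rw [neg_neg, cdf_eq_real]
      exact measureReal_mono fun x hx => le_csSup ⟨z, fun x hx => hx.2⟩ hx
    calc _ ≤ cdf γ₁ (- -c) * φ₁ r :=
          mul_le_mul_of_nonneg_right ((min_le_left _ _).trans h2) hr
      _ ≤ cdf γ₁ (-r) * φ₁ (-c) := cdf_gaussianReal_neg_mul_le (by linarith)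
      _ ≤ _ := by
        rw [gaussianPDFReal_zero_one_neg]
        exact mul_le_mul_of_nonneg_left (by linarith) hm

theorem rightEndsBound_compl_inter_Ici {A : Set ℝ} (hA : IsClosed A) {r : ℝ} (hr : 0 ≤ r)
    (hrA : r ∈ A) :
    RightEndsBound A r (cdf γ₁ (-r)) ((γ₁).real (Aᶜ ∩ Ici r)) := by
  have hm : 0 ≤ cdf γ₁ (-r) := cdf_nonneg _ _
  rcases (Aᶜ ∩ Ici r).eq_empty_or_nonempty with h | h
  · left
    rw [h]
    simp
  right
  intro ε hε
  have hbdd : BddBelow (Aᶜ ∩ Ici r) := ⟨r, fun x hx => hx.2⟩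
  set R := sInf (Aᶜ ∩ Ici r) with hR
  have hrR : r ≤ R := le_csInf h fun x hx => hx.2
  obtain ⟨δ, hδ, hδR⟩ := Metric.continuous_iff.1 continuous_gaussianPDFReal_zero_one R ε hε
  obtain ⟨z, hz, hzR⟩ := exists_lt_of_csInf_lt h (lt_add_of_pos_right R hδ)
  have hRz : R ≤ z := csInf_le hbdd hz
  obtain ⟨hc, hcz⟩ := isRightEnd_sSup hA hz.1 ⟨r, hrA, hz.2⟩
  have hrc : r ≤ sSup (A ∩ Iic z) := le_csSup ⟨z, fun x hx => hx.2⟩ ⟨hrA, hz.2⟩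
  set c := sSup (A ∩ Iic z)
  refine ⟨c, hc, ?_⟩
  have h1 : φ₁ z ≤ φ₁ c := gaussianPDFReal_zero_one_le (by
    rw [abs_of_nonneg (hr.trans hrc), abs_of_nonneg (hr.trans hz.2)]
    exact hcz.le)
  have h2 := hδR z (by rw [Real.dist_eq, abs_of_nonneg] <;> linarith)
  rw [Real.dist_eq] at h2
  have h3 := (abs_lt.1 h2).1
  have h4 : (γ₁).real (Aᶜ ∩ Ici r) ≤ cdf γ₁ (-R) := by
    rw [cdf_eq_real, ← measureReal_gaussianReal_neg (Iic (-R))]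
    exact measureReal_mono fun x hx => neg_le_neg (csInf_le hbdd hx)
  calc _ ≤ cdf γ₁ (-R) * φ₁ r := mul_le_mul_of_nonneg_right h4 (gaussianPDFReal_nonneg 0 1 r)
    _ ≤ cdf γ₁ (-r) * φ₁ R := cdf_gaussianReal_neg_mul_le hrR
    _ ≤ _ := mul_le_mul_of_nonneg_left (by linarith) hm

theorem gaussianPDFReal_le_boundaryMeasure_of_isClosed {A : Set ℝ} (hA : IsClosed A) {r : ℝ}
    (hr : 0 ≤ r) (hm : 0 < cdf γ₁ (-r)) (h : cdf γ₁ (-r) ≤ (γ₁).real A)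
    (h' : cdf γ₁ (-r) ≤ (γ₁).real Aᶜ) :
    ENNReal.ofReal (φ₁ r) ≤ boundaryMeasure γ₁ A := by
  have hA' : IsClosed (Neg.neg ⁻¹' A) := hA.preimage continuous_neg
  by_cases hz : ∃ z, z ∉ A ∧ |z| ≤ r
  · obtain ⟨z, hz, hzr⟩ := hz
    have h1 := rightEndsBound_inter_Iic hA hz hzr
    have h2 := rightEndsBound_inter_Iic hA' (r := r) (z := -z) (by simpa using hz)
      (by rwa [abs_neg])
    refine h1.ofReal_le hm h2 ?_
    have h3 : (γ₁).real (Neg.neg ⁻¹' A ∩ Iic (-z)) = (γ₁).real (A ∩ Ici z) := by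
      rw [← measureReal_gaussianReal_neg (A ∩ Ici z)]
      congr 1
      ext x
      simp
    have h4 : (γ₁).real A ≤ (γ₁).real (A ∩ Iic z) + (γ₁).real (A ∩ Ici z) := by
      refine le_trans (measureReal_mono ?_) (measureReal_union_le _ _)
      rw [← inter_union_distrib_left, Iic_union_Ici, inter_univ]
    rw [h3]
    have h5 : 0 ≤ (γ₁).real (A ∩ Iic z) := measureReal_nonneg
    have h6 : 0 ≤ (γ₁).real (A ∩ Ici z) := measureReal_nonneg
    rcases min_cases ((γ₁).real (A ∩ Iic z)) (cdf γ₁ (-r)) with h7 | h7 <;>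
    rcases min_cases ((γ₁).real (A ∩ Ici z)) (cdf γ₁ (-r)) with h8 | h8 <;> linarith
  · push Not at hz
    have hrA : ∀ z, |z| ≤ r → z ∈ A := fun z hzr => by
      by_contra hzA
      exact (hz z hzA).not_ge hzr
    have h1 := rightEndsBound_compl_inter_Ici hA hr (hrA r (abs_of_nonneg hr).le)
    have h2 := rightEndsBound_compl_inter_Ici hA' hr
      (hrA (-r) (by rw [abs_neg]; exact (abs_of_nonneg hr).le))
    refine h1.ofReal_le hm h2 (h'.trans ?_)
    rw [← measureReal_gaussianReal_neg ((Neg.neg ⁻¹' A)ᶜ ∩ Ici r)]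
    refine le_trans (measureReal_mono fun x hx => ?_) (measureReal_union_le _ _)
    have hxr : r < |x| := hz x hx
    rcases lt_abs.1 hxr with h3 | h3
    · exact Or.inl ⟨hx, h3.le⟩
    · exact Or.inr ⟨by simpa using hx, h3.le⟩

theorem strictMono_cdf_gaussianReal : StrictMono (cdf γ₁) :=
  strictMono_of_deriv_pos fun x => by
    rw [(hasDerivAt_cdf_gaussianReal x).deriv]
    exact gaussianPDFReal_pos 0 1 x one_ne_zero

/-- The Gaussian isoperimetric inequality on the line. -/
theorem gaussianPDFReal_le_boundaryMeasure {A : Set ℝ} {s : ℝ}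
    (hs : cdf γ₁ s = (γ₁).real A) :
    ENNReal.ofReal (φ₁ s) ≤ boundaryMeasure γ₁ A := by
  rcases eq_or_lt_of_le (measureReal_mono (μ := γ₁) (subset_closure (s := A))) with h | h
  · have hb : boundaryMeasure γ₁ (closure A) = boundaryMeasure γ₁ A := by
      have h2 : γ₁ (closure A) = γ₁ A := by
        rw [← ofReal_measureReal, ← h, ofReal_measureReal]
      simp only [boundaryMeasure, Metric.cthickening_closure, h2]
    rw [← hb, ← gaussianPDFReal_zero_one_abs]
    have hsymm : ∀ x, cdf γ₁ (-x) = 1 - cdf γ₁ x := fun x => by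
      have := nullSingletonClass_gaussianReal (μ := 0) (v := 1) one_ne_zero
      rw [← measureReal_Ici_eq_one_sub_cdf, cdf_eq_real, ← measureReal_gaussianReal_neg]
      congr 1
      ext y
      simp
    refine gaussianPDFReal_le_boundaryMeasure_of_isClosed isClosed_closure (abs_nonneg s)
      ((cdf_nonneg γ₁ (-|s| - 1)).trans_lt (strictMono_cdf_gaussianReal (by linarith))) ?_ ?_
    · rw [← h, ← hs]
      exact monotone_cdf γ₁ (neg_abs_le s)
    · rw [measureReal_compl isClosed_closure.measurableSet, ← h, ← hs, probReal_univ,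
        ← hsymm]
      exact monotone_cdf γ₁ (neg_le_neg (le_abs_self s))
  · refine ofReal_le_boundaryMeasure fun ε hε => ?_
    have hlim : Tendsto (fun x : ℝ => (γ₁).real A + (φ₁ s - ε) * x) (𝓝[>] 0)
        (𝓝 ((γ₁).real A + (φ₁ s - ε) * 0)) :=
      (Continuous.tendsto (by fun_prop) 0).mono_left nhdsWithin_le_nhds
    rw [mul_zero, add_zero] at hlim
    filter_upwards [hlim.eventually (eventually_lt_nhds h)] with x hx
    exact hx.le.trans (measureReal_mono (Metric.closure_subset_cthickening x A))

theorem isopFun_eq_zero_of_zero {E : Type*} [MeasurableSpace E] [PseudoEMetricSpace E]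
    (τ : Measure E) [IsFiniteMeasure τ] : isopFun τ 0 = 0 := by
  refine le_antisymm ((isopFun_le_boundaryMeasure MeasurableSet.empty (by simp)).trans ?_) bot_le
  refine (boundaryMeasure_le_ofReal (C := 0) le_rfl ?_).trans (by simp)
  exact Eventually.of_forall fun h => by simp

theorem isopFun_eq_zero_of_one {E : Type*} [MeasurableSpace E] [PseudoEMetricSpace E]
    (τ : Measure E) [IsProbabilityMeasure τ] : isopFun τ 1 = 0 := by
  refine le_antisymm ((isopFun_le_boundaryMeasure MeasurableSet.univ (by simp)).trans ?_) bot_le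
  refine (boundaryMeasure_le_ofReal (C := 0) le_rfl ?_).trans (by simp)
  exact Eventually.of_forall fun h => by simp

theorem exists_cdf_gaussianReal_eq {t : ℝ} (ht : t ∈ Ioo (0 : ℝ) 1) : ∃ s, cdf γ₁ s = t := by
  have hc : Continuous (cdf γ₁) :=
    continuous_iff_continuousAt.2 fun x => (hasDerivAt_cdf_gaussianReal x).continuousAt
  obtain ⟨a, ha⟩ := ((tendsto_cdf_atBot γ₁).eventually (eventually_lt_nhds ht.1)).exists
  obtain ⟨b, hb⟩ := ((tendsto_cdf_atTop γ₁).eventually (eventually_gt_nhds ht.2)).exists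
  exact mem_range_of_exists_le_of_exists_ge hc ⟨a, ha.le⟩ ⟨b, hb.le⟩

theorem cdf_gaussianReal_sq {σ : ℝ} (hσ : 0 < σ) (x : ℝ) :
    cdf (gaussianReal 0 (σ ^ 2).toNNReal) x = cdf γ₁ (x / σ) := by
  have h := gaussianReal_map_const_mul (μ := 0) (v := 1) σ
  rw [mul_zero, mul_one] at h
  have hσ2 : NNReal.mk (σ ^ 2) (sq_nonneg σ) = (σ ^ 2).toNNReal :=
    (Real.toNNReal_of_nonneg (sq_nonneg σ)).symm
  rw [hσ2] at h
  rw [cdf_eq_real, cdf_eq_real, ← h, map_measureReal_apply (by fun_prop) measurableSet_Iic]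
  · congr 1
    ext y
    simp [le_div_iff₀ hσ, mul_comm]

theorem variance_ne_zero_of_nullSingletonClass {μ : Measure ℝ} [IsProbabilityMeasure μ]
    [NullSingletonClass μ] (h : MemLp (fun x => x) 2 μ) : Var[fun x => x; μ] ≠ 0 := by
  intro h0
  have h1 := ae_eq_integral_of_variance_eq_zero h h0
  have h2 : ∀ᵐ x ∂μ, x ≠ ∫ x, x ∂μ := by simp [ae_iff]
  obtain ⟨x, hx, hx'⟩ := (h1.and h2).exists
  exact hx' hx

theorem memLp_two_of_integrable_abs_pow_three {μ : Measure ℝ} [IsFiniteMeasure μ]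
    (h : Integrable (fun x => |x| ^ 3) μ) : MemLp (fun x => x) 2 μ := by
  have h3 : MemLp (fun x : ℝ => x) 3 μ := by
    have := (integrable_norm_rpow_iff (μ := μ) (f := fun x : ℝ => x) (p := 3)
      aestronglyMeasurable_id (by simp) (by simp)).1 ?_
    · exact this
    · refine h.congr (Eventually.of_forall fun x => ?_)
      norm_num
  exact h3.mono_exponent (by norm_num)

theorem withDensity_eq_gaussianReal :
    (volume.withDensity fun x : ℝ => ENNReal.ofReal (rexp (-(x ^ 2) / 2) / √(2 * π))) = γ₁ := by
  rw [gaussianReal_of_var_ne_zero _ one_ne_zero]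
  congr 1
  ext x
  rw [gaussianPDF, gaussianPDFReal]
  congr 1
  simp only [NNReal.coe_one, mul_one, sub_zero]
  ring

/-- The central limit theorem for the product measures bounds their isoperimetric functions. -/
theorem iInf_isopFun_withDensity_le {g : ℝ → ℝ≥0∞} (hg : Measurable g)
    [IsProbabilityMeasure (volume.withDensity g)]
    (hL2 : MemLp (fun x => x) 2 (volume.withDensity g)) {σ : ℝ} (hσ : 0 < σ)
    (hvar : Var[fun x => x; volume.withDensity g] = σ ^ 2) (s : ℝ) :
    (⨅ N : ℕ, isopFun
        (volume.withDensity fun x : EuclideanSpace ℝ (Fin (N + 1)) => ∏ i, g (x i)) (cdf γ₁ s))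
      ≤ ENNReal.ofReal (1 / σ * φ₁ s) := by
  set μ := volume.withDensity g with hμ
  have hmap := fun n : ℕ => map_euclideanTruncation (n + 1) hg
  have hT := fun n : ℕ => measurable_euclideanTruncation (n + 1)
  have hSm := fun n : ℕ => (lipschitzWith_normalizedSum (∫ x, x ∂μ) n).continuous.measurable
  have hym := fun n : ℕ => (lipschitzWith_eval_last n).continuous.measurable
  have hprob : ∀ n : ℕ, IsProbabilityMeasure
      (volume.withDensity fun x : EuclideanSpace ℝ (Fin (n + 1)) => ∏ i, g (x i)) := fun n => by
    rw [← hmap n]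
    exact Measure.isProbabilityMeasure_map (hT n).aemeasurable
  have hF : HasDerivAt (fun x => cdf γ₁ (x / σ)) (1 / σ * φ₁ s) (s * σ) := by
    have h1 : HasDerivAt (fun x : ℝ => x / σ) (1 / σ) (s * σ) := (hasDerivAt_id _).div_const σ
    have h2 := hasDerivAt_cdf_gaussianReal (s * σ / σ)
    have h3 := h2.comp (s * σ) h1
    rw [mul_div_cancel_right₀ _ hσ.ne', mul_comm] at h3
    exact h3
  have h := iInf_isopFun_le_of_tendsto_cdf
    (fun n : ℕ => volume.withDensity fun x : EuclideanSpace ℝ (Fin (n + 1)) => ∏ i, g (x i))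
    (withDensity_absolutelyContinuous volume g) (S := normalizedSum (∫ x, x ∂μ))
    (y := fun n x => x (Fin.last n)) hSm hym (fun n => ?_) (fun n => ?_)
    (lipschitzWith_normalizedSum _) lipschitzWith_eval_last
    (strictMono_cdf_gaussianReal.comp (strictMono_div_right_of_pos hσ)) (fun x => ?_) hF
  · simpa only [Function.comp_apply, mul_div_cancel_right₀ s hσ.ne'] using h
  · rw [← hmap n, Measure.map_map (hym n) (hT n)]
    exact Measure.infinitePi_map_eval (fun _ : ℕ => μ) n
  · rw [indepFun_iff_measure_inter_preimage_eq_mul]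
    intro B C hB hC
    rw [← hmap n, Measure.map_apply (hT n) ((hSm n hB).inter (hym n hC)),
      Measure.map_apply (hT n) (hSm n hB), Measure.map_apply (hT n) (hym n hC)]
    exact (indepFun_normalizedSum_last (∫ x, x ∂μ) n μ).measure_inter_preimage_eq_mul _ _ hB hC
  · have h1 := tendsto_cdf_normalizedSum μ hL2 (by rw [hvar]; positivity) x
    rw [hvar, cdf_gaussianReal_sq hσ] at h1
    refine h1.congr fun n => ?_
    rw [← hmap n, Measure.map_map (hSm n) (hT n)]
    rfl

end

/-- For a probability measure `μ` on `ℝ` with density `g` and finite third moment, with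
`σ² = Var_μ(x)`, the infinite dimensional isoperimetric function satisfies
`I_{μ^∞}(t) = inf_{N ≥ 1} I_{μ^N}(t) ≤ (1/σ) I_γ(t)` for every `t ∈ [0,1]`, where `γ` is
the standard Gaussian measure on `ℝ`. -/
theorem infinite_dimensional_isoperimetry_gaussian_upper_bound
    (μ : Measure ℝ) (hμp : IsProbabilityMeasure μ)
    (g : ℝ → ℝ≥0∞) (hg : Measurable g) (hμ : μ = volume.withDensity g)
    (hmom : Integrable (fun x => |x| ^ 3) μ)
    (σ : ℝ) (hσ : σ = Real.sqrt (variance (fun x => x) μ))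
    (t : ℝ) (ht : t ∈ Set.Icc (0 : ℝ) 1) :
    (⨅ N : ℕ, isopFun
        (volume.withDensity fun x : EuclideanSpace ℝ (Fin (N + 1)) => ∏ i, g (x i)) t)
      ≤ ENNReal.ofReal (1 / σ) *
        isopFun (volume.withDensity fun x : ℝ =>
          ENNReal.ofReal (Real.exp (-(x ^ 2) / 2) / Real.sqrt (2 * Real.pi))) t := by
  subst hμ
  have hna : NullSingletonClass (volume.withDensity g) :=
    ⟨fun x => withDensity_absolutelyContinuous volume g (measure_singleton x)⟩
  have hL2 := memLp_two_of_integrable_abs_pow_three hmom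
  have hσ0 : 0 < σ := hσ ▸ Real.sqrt_pos.2
    (lt_of_le_of_ne (variance_nonneg _ _) (variance_ne_zero_of_nullSingletonClass hL2).symm)
  have hvar : Var[fun x => x; volume.withDensity g] = σ ^ 2 := by
    rw [hσ, Real.sq_sqrt (variance_nonneg _ _)]
  have hprob : IsProbabilityMeasure
      (volume.withDensity fun x : EuclideanSpace ℝ (Fin (0 + 1)) => ∏ i, g (x i)) := by
    rw [withDensity_prod_eq_map_pi hg]
    exact Measure.isProbabilityMeasure_map (WithLp.measurable_toLp 2 _).aemeasurable
  rcases eq_or_lt_of_le ht.1 with rfl | h0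
  · exact (iInf_le _ 0).trans ((isopFun_eq_zero_of_zero _).le.trans bot_le)
  rcases eq_or_lt_of_le ht.2 with rfl | h1
  · exact (iInf_le _ 0).trans ((isopFun_eq_zero_of_one _).le.trans bot_le)
  obtain ⟨s, rfl⟩ := exists_cdf_gaussianReal_eq ⟨h0, h1⟩
  refine (iInf_isopFun_withDensity_le hg hL2 hσ0 hvar s).trans ?_
  rw [ENNReal.ofReal_mul (by positivity), withDensity_eq_gaussianReal]
  refine mul_le_mul_right (le_sInf ?_) _
  rintro _ ⟨A, _, hA, rfl⟩
  exact gaussianPDFReal_le_boundaryMeasure hA.symm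
end

section
/- Let Λ be the logistic measure on ℝ with density f(x) = e^x/(1+e^x)², and let Λ^{N+1} be its (N+1)-fold product on ℝ^{N+1}. If |t| ≥ 2 log(2+√3), then the coordinate half-space H^{N+1}_t = {x ∈ ℝ^{N+1} : x_{N+1} < t} is stable for Λ^{N+1}. -/
open MeasureTheory Real
open scoped ENNReal

/-- The logistic density `f(x) = eˣ/(1+eˣ)²`. -/
noncomputable def logisticDensity (x : ℝ) : ℝ := Real.exp x / (1 + Real.exp x) ^ 2

/-- The log-density `ψ = ln f` of the logistic measure. -/
noncomputable def logisticPsi (x : ℝ) : ℝ := Real.log (logisticDensity x)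

/-- Stability of the half-space `H = {x ∈ ℝ^{n+1} : ⟨x,v⟩ < t}` for the product measure
whose density is `e^{φ(x)} = ∏ᵢ e^{ψ(xᵢ)}`: for every parametrization of the boundary
hyperplane by an affine isometry `p : ℝⁿ → ℝ^{n+1}` and every `u ∈ C_c^∞(∂H)` with
`∫_{∂H} u e^φ da = 0` one has `∫_{∂H} (|∇_{∂H} u|² + u² ∑ᵢ ψ''(xᵢ) vᵢ²) e^φ da ≥ 0`. -/
def HalfSpaceStable {n : ℕ} (ψ : ℝ → ℝ)
    (v : EuclideanSpace ℝ (Fin (n + 1))) (t : ℝ) : Prop :=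
  ∀ p : EuclideanSpace ℝ (Fin n) →ᵃⁱ[ℝ] EuclideanSpace ℝ (Fin (n + 1)),
    Set.range p = {x : EuclideanSpace ℝ (Fin (n + 1)) | ∑ i, x i * v i = t} →
    ∀ u : EuclideanSpace ℝ (Fin n) → ℝ,
      ContDiff ℝ (⊤ : ℕ∞) u → HasCompactSupport u →
      (∫ z : EuclideanSpace ℝ (Fin n), u z * ∏ i, Real.exp (ψ (p z i))) = 0 →
      0 ≤ ∫ z : EuclideanSpace ℝ (Fin n),
          (‖gradient u z‖ ^ 2 + u z ^ 2 * ∑ i, deriv (deriv ψ) (p z i) * v i ^ 2) *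
            ∏ i, Real.exp (ψ (p z i))

theorem logisticDensity_eq (x : ℝ) :
    logisticDensity x = 1 / (4 * Real.cosh (x / 2) ^ 2) := by
  have h : Real.exp x = Real.exp (x / 2) ^ 2 := by
    rw [← Real.exp_nat_mul]; congr 1; push_cast; ring
  have hp := Real.exp_pos (x / 2)
  rw [logisticDensity, h, Real.cosh_eq, Real.exp_neg]
  field_simp
  ring

theorem logisticDensity_pos (x : ℝ) : 0 < logisticDensity x := by
  unfold logisticDensity; positivity

theorem logisticDensity_neg (x : ℝ) : logisticDensity (-x) = logisticDensity x := by
  rw [logisticDensity_eq, logisticDensity_eq, neg_div, Real.cosh_neg]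

theorem continuous_logisticDensity : Continuous logisticDensity := by
  unfold logisticDensity
  exact Real.continuous_exp.div (by fun_prop) fun x ↦ by positivity

theorem logisticDensity_eq_sigmoid (x : ℝ) :
    logisticDensity x = Real.sigmoid x * (1 - Real.sigmoid x) := by
  have hp := Real.exp_pos x
  rw [logisticDensity, Real.sigmoid_def, Real.exp_neg]
  field_simp
  ring

theorem integrable_logisticDensity : Integrable logisticDensity := by
  have hd : ∀ x, HasDerivAt Real.sigmoid (logisticDensity x) x := fun x ↦ by
    rw [logisticDensity_eq_sigmoid]; exact Real.hasDerivAt_sigmoid x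
  rw [← integrableOn_univ, ← Set.Iic_union_Ioi (a := (0 : ℝ)), integrableOn_union]
  have h : IntegrableOn logisticDensity (Set.Ioi 0) :=
    integrableOn_Ioi_deriv_of_nonneg' (fun x _ ↦ hd x) (fun x _ ↦ (logisticDensity_pos x).le)
      Real.tendsto_sigmoid_atTop
  refine ⟨?_, h⟩
  have h2 : IntegrableOn (fun x ↦ logisticDensity (-x)) (Set.Iio 0) :=
    IntegrableOn.comp_neg_Iio (by rwa [neg_zero])
  rw [integrableOn_Iic_iff_integrableOn_Iio]
  exact h2.congr_fun (fun x _ ↦ logisticDensity_neg x) measurableSet_Iio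

theorem integral_logisticDensity : ∫ x, logisticDensity x = 1 := by
  have hd : ∀ x, HasDerivAt Real.sigmoid (logisticDensity x) x := fun x ↦ by
    rw [logisticDensity_eq_sigmoid]; exact Real.hasDerivAt_sigmoid x
  rw [integral_of_hasDerivAt_of_tendsto hd integrable_logisticDensity
    Real.tendsto_sigmoid_atBot Real.tendsto_sigmoid_atTop, sub_zero]

/-- The logistic measure. -/
noncomputable def logisticMeasure : Measure ℝ :=
  volume.withDensity fun x ↦ ENNReal.ofReal (logisticDensity x)

instance isProbabilityMeasure_logisticMeasure : IsProbabilityMeasure logisticMeasure := by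
  refine ⟨?_⟩
  rw [logisticMeasure, withDensity_apply _ MeasurableSet.univ, Measure.restrict_univ,
    ← ofReal_integral_eq_lintegral_ofReal integrable_logisticDensity
      (Filter.Eventually.of_forall fun x ↦ (logisticDensity_pos x).le),
    integral_logisticDensity, ENNReal.ofReal_one]

theorem integral_logisticMeasure (g : ℝ → ℝ) :
    ∫ x, g x ∂logisticMeasure = ∫ x, g x * logisticDensity x := by
  rw [logisticMeasure, integral_withDensity_eq_integral_toReal_smul
    (continuous_logisticDensity.measurable.ennreal_ofReal) (by simp)]
  simp [ENNReal.toReal_ofReal (logisticDensity_pos _).le, mul_comm]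

/-- A nonnegative subsolution of the Riccati equation `k' = -f/8 - k²/f` on `[0, ∞)`, namely
`k = f h'/h` with `h(x) = 4 sinh (x/2) + 1 / cosh (x/2)`. -/
noncomputable def riccatiSub (x : ℝ) : ℝ :=
  (4 * Real.cosh (x / 2) ^ 3 - Real.sinh (x / 2)) /
    (8 * Real.cosh (x / 2) ^ 3 * (4 * Real.sinh (x / 2) * Real.cosh (x / 2) + 1))

theorem riccatiSub_nonneg {x : ℝ} (hx : 0 ≤ x) : 0 ≤ riccatiSub x := by
  have hc := Real.one_le_cosh (x / 2)
  have hs : 0 ≤ Real.sinh (x / 2) := Real.sinh_nonneg_iff.2 (by positivity)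
  have hlt := Real.sinh_lt_cosh (x / 2)
  have h3 : Real.cosh (x / 2) ≤ Real.cosh (x / 2) ^ 3 := le_self_pow₀ hc (by norm_num)
  unfold riccatiSub
  apply div_nonneg
  · linarith
  · positivity

theorem exists_hasDerivAt_riccatiSub {x : ℝ} (hx : 0 ≤ x) :
    ∃ k', HasDerivAt riccatiSub k' x ∧
      k' ≤ -(logisticDensity x / 8) - riccatiSub x ^ 2 / logisticDensity x := by
  have hy : HasDerivAt (fun x : ℝ ↦ x / 2) (1 / 2) x := (hasDerivAt_id x).div_const 2
  have hC := hy.cosh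
  have hS := hy.sinh
  have hc := Real.one_le_cosh (x / 2)
  have hs : 0 ≤ Real.sinh (x / 2) := Real.sinh_nonneg_iff.2 (by positivity)
  have hsq := Real.cosh_sq (x / 2)
  have hB : (8 * Real.cosh (x / 2) ^ 3 * (4 * Real.sinh (x / 2) * Real.cosh (x / 2) + 1)) ≠ 0 := by
    positivity
  have hK := (((hC.pow 3).const_mul 4).sub hS).div
    (((hC.pow 3).const_mul 8).mul (((hS.const_mul 4).mul hC).add_const 1)) hB
  refine ⟨_, hK, ?_⟩
  rw [logisticDensity_eq]
  unfold riccatiSub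
  simp only [Pi.pow_apply, Pi.mul_apply, Pi.sub_apply]
  generalize Real.cosh (x / 2) = c at *
  generalize Real.sinh (x / 2) = s at *
  have hpos : 0 ≤ 4 * s * c ^ 3 + 1 - 7 * s ^ 2 := by
    have h1 : c ^ 2 ≤ c ^ 3 := pow_le_pow_right₀ hc (by norm_num)
    nlinarith [mul_le_mul_of_nonneg_left h1 hs, mul_nonneg hs (sq_nonneg (8 * s - 7))]
  have h0 : 0 ≤ (4 * s * c ^ 3 + 1 - 7 * s ^ 2) / (32 * c ^ 4 * (4 * s * c + 1)) := by positivity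
  rw [← sub_nonneg]
  convert h0 using 1
  push_cast
  field_simp
  grind

theorem half_line_hardy {w w' : ℝ → ℝ} (hw : ∀ x, HasDerivAt w (w' x) x) (hw' : Continuous w')
    (h0 : w 0 = 0) {R : ℝ} (hR : 0 ≤ R) :
    0 ≤ ∫ x in (0 : ℝ)..R, (w' x ^ 2 - w x ^ 2 / 8) * logisticDensity x := by
  have hwc : Continuous w := continuous_iff_continuousAt.2 fun x ↦ (hw x).continuousAt
  choose! k' hk' hk'le using fun x : ℝ ↦ exists_hasDerivAt_riccatiSub (x := x)
  have hG : ∀ x, 0 ≤ x → HasDerivAt (fun x ↦ w x ^ 2 * riccatiSub x)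
      (2 * w x * w' x * riccatiSub x + w x ^ 2 * k' x) x := fun x hx ↦ by
    have := ((hw x).pow 2).mul (hk' x hx)
    simp only [Nat.cast_ofNat, Nat.add_one_sub_one, pow_one] at this
    exact this
  have key := intervalIntegral.sub_le_integral_of_hasDeriv_right_of_le
    (g := fun x ↦ w x ^ 2 * riccatiSub x)
    (φ := fun x ↦ (w' x ^ 2 - w x ^ 2 / 8) * logisticDensity x) hR
    (fun x hx ↦ (hG x hx.1).continuousAt.continuousWithinAt)
    (fun x hx ↦ (hG x hx.1.le).hasDerivWithinAt)
    (Continuous.integrableOn_Icc (((hw'.pow 2).sub ((hwc.pow 2).div_const 8)).mul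
      continuous_logisticDensity)) ?_
  · have := riccatiSub_nonneg hR
    refine le_trans ?_ key
    simpa [h0] using mul_nonneg (sq_nonneg (w R)) this
  · intro x hx
    have hf := logisticDensity_pos x
    have h1 := mul_le_mul_of_nonneg_left (hk'le x hx.1.le) (sq_nonneg (w x))
    have h2 : 0 ≤ (w' x * logisticDensity x - w x * riccatiSub x) ^ 2 / logisticDensity x := by
      positivity
    have h3 : (w' x * logisticDensity x - w x * riccatiSub x) ^ 2 / logisticDensity x =
        w' x ^ 2 * logisticDensity x - 2 * w x * w' x * riccatiSub x +
          w x ^ 2 * (riccatiSub x ^ 2 / logisticDensity x) := by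
      field_simp
      ring
    rw [h3] at h2
    linarith

theorem integral_sub_const_sq {α : Type*} [MeasurableSpace α] {μ : Measure α}
    [IsProbabilityMeasure μ] {X : α → ℝ} (h1 : Integrable X μ) (h2 : Integrable (fun x ↦ X x ^ 2) μ)
    (a : ℝ) : ∫ x, (X x - a) ^ 2 ∂μ = ∫ x, X x ^ 2 ∂μ - 2 * a * ∫ x, X x ∂μ + a ^ 2 := by
  have : (fun x ↦ (X x - a) ^ 2) = fun x ↦ (X x ^ 2 - 2 * a * X x) + a ^ 2 := by
    ext x; ring
  have h3 : Integrable (fun x ↦ X x ^ 2 - 2 * a * X x) μ := h2.sub (h1.const_mul _)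
  rw [this, integral_add h3 (integrable_const _), integral_sub h2 (h1.const_mul _),
    integral_const_mul]
  simp

/-- Poincaré inequality for the logistic measure (with a non-optimal constant). -/
theorem logisticMeasure_poincare {u u' : ℝ → ℝ} {C : ℝ} (hu : ∀ x, HasDerivAt u (u' x) x)
    (hu' : Continuous u') (hC : ∀ x, |u x| ≤ C) (hC' : ∀ x, |u' x| ≤ C) :
    ∫ x, u x ^ 2 ∂logisticMeasure - (∫ x, u x ∂logisticMeasure) ^ 2 ≤
      8 * ∫ x, u' x ^ 2 ∂logisticMeasure := by
  have huc : Continuous u := continuous_iff_continuousAt.2 fun x ↦ (hu x).continuousAt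
  have bdd : ∀ {g : ℝ → ℝ}, Continuous g → (∀ x, |g x| ≤ C) →
      Integrable g logisticMeasure ∧ Integrable (fun x ↦ g x ^ 2) logisticMeasure :=
    fun hg hb ↦ ⟨.of_bound hg.aestronglyMeasurable C (.of_forall hb),
      .of_bound (hg.pow 2).aestronglyMeasurable (C ^ 2) (.of_forall fun x ↦ by
        rw [norm_pow]; exact pow_le_pow_left₀ (norm_nonneg _) (hb x) 2)⟩
  obtain ⟨iu, iu2⟩ := bdd huc hC
  obtain ⟨-, iu'2⟩ := bdd hu' hC'
  set a := u 0 with ha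
  have iw : Integrable (fun x ↦ (u x - a) ^ 2) logisticMeasure := by
    have := (iu2.sub (iu.const_mul (2 * a))).add (integrable_const (a ^ 2))
    refine this.congr (.of_forall fun x ↦ ?_)
    simp only [Pi.add_apply, Pi.sub_apply]
    ring
  have hint : Integrable (fun x ↦ (u' x ^ 2 - (u x - a) ^ 2 / 8) * logisticDensity x) := by
    have := (iu'2.sub (iw.div_const 8))
    rw [logisticMeasure, integrable_withDensity_iff_integrable_smul'
      (continuous_logisticDensity.measurable.ennreal_ofReal) (by simp)] at this
    refine this.congr (.of_forall fun x ↦ ?_)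
    simp [ENNReal.toReal_ofReal (logisticDensity_pos _).le, mul_comm]
  have hlim := intervalIntegral_tendsto_integral hint Filter.tendsto_neg_atTop_atBot
    (Filter.tendsto_id (α := ℝ))
  have hc : Continuous fun x ↦ (u' x ^ 2 - (u x - a) ^ 2 / 8) * logisticDensity x :=
    ((hu'.pow 2).sub (((huc.sub continuous_const).pow 2).div_const 8)).mul
      continuous_logisticDensity
  have hnn : 0 ≤ ∫ x, (u' x ^ 2 - (u x - a) ^ 2 / 8) * logisticDensity x := by
    refine ge_of_tendsto hlim ?_
    filter_upwards [Filter.eventually_ge_atTop 0] with R hR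
    rw [← intervalIntegral.integral_add_adjacent_intervals (hc.intervalIntegrable _ 0)
      (hc.intervalIntegrable 0 _)]
    refine add_nonneg ?_ ?_
    · have := half_line_hardy (w := fun x ↦ u (-x) - a) (w' := fun x ↦ -u' (-x))
        (fun x ↦ by
          have := ((hu (-x)).scomp x (hasDerivAt_neg x)).sub_const a
          simpa using this)
        (by fun_prop) (by simp [ha]) hR
      have h2 := intervalIntegral.integral_comp_neg (a := 0) (b := R)
        fun x ↦ (u' x ^ 2 - (u x - a) ^ 2 / 8) * logisticDensity x
      rw [neg_zero] at h2
      rw [← h2]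
      simpa [logisticDensity_neg] using this
    · exact half_line_hardy (w := fun x ↦ u x - a) (fun x ↦ (hu x).sub_const a) hu'
        (by simp [ha]) hR
  rw [← integral_logisticMeasure (fun x ↦ u' x ^ 2 - (u x - a) ^ 2 / 8),
    integral_sub iu'2 (iw.div_const 8), integral_div] at hnn
  rw [integral_sub_const_sq iu iu2] at hnn
  nlinarith [sq_nonneg (∫ x, u x ∂logisticMeasure - a)]

theorem integrable_of_continuous_of_bound {X : Type*} [TopologicalSpace X] [MeasurableSpace X]
    [OpensMeasurableSpace X] {μ : Measure X} [IsFiniteMeasure μ]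
    {g : X → ℝ} (hg : Continuous g) {C : ℝ} (hC : ∀ x, |g x| ≤ C) : Integrable g μ :=
  .of_bound hg.measurable.aestronglyMeasurable C (.of_forall hC)

theorem abs_sq_le_of_abs_le {a C : ℝ} (h : |a| ≤ C) : |a ^ 2| ≤ C ^ 2 := by
  rw [abs_pow]; exact pow_le_pow_left₀ (abs_nonneg _) h 2

theorem abs_integral_le_of_abs_le {α : Type*} [MeasurableSpace α] {μ : Measure α}
    [IsProbabilityMeasure μ] {X : α → ℝ} {C : ℝ} (hX : ∀ x, |X x| ≤ C) : |∫ x, X x ∂μ| ≤ C := by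
  simpa using norm_integral_le_of_norm_le_const (μ := μ) (f := X) (.of_forall hX)

theorem continuous_comp_finCons {n : ℕ} {F : (Fin (n + 1) → ℝ) → ℝ} (hF : Continuous F) :
    Continuous fun z : ℝ × (Fin n → ℝ) ↦ F (Fin.cons z.1 z.2) :=
  hF.comp (Continuous.finCons (A := fun _ ↦ ℝ) continuous_fst continuous_snd)

/-- Integrating out one variable decreases the variance at least as much as the average. -/
theorem variance_marginal_le {α β : Type*} [MeasurableSpace α] [MeasurableSpace β]
    {μ : Measure α} {ν : Measure β} [IsProbabilityMeasure μ] [IsProbabilityMeasure ν]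
    {U : α → β → ℝ} (hU : StronglyMeasurable (Function.uncurry U)) {C : ℝ}
    (hC : ∀ x y, |U x y| ≤ C) :
    ∫ x, (∫ y, U x y ∂ν) ^ 2 ∂μ - (∫ x, ∫ y, U x y ∂ν ∂μ) ^ 2 ≤
      ∫ y, (∫ x, U x y ^ 2 ∂μ - (∫ x, U x y ∂μ) ^ 2) ∂ν := by
  set g : α → ℝ := fun x ↦ ∫ y, U x y ∂ν with hg
  set h : β → ℝ := fun y ↦ ∫ x, U x y ∂μ with hh
  set m := ∫ x, g x ∂μ with hm
  have hgm : StronglyMeasurable g := hU.integral_prod_right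
  have hhm : StronglyMeasurable h := hU.integral_prod_left
  have hgC : ∀ x, |g x| ≤ C := fun x ↦ abs_integral_le_of_abs_le (hC x)
  have hhC : ∀ y, |h y| ≤ C := fun y ↦ abs_integral_le_of_abs_le fun x ↦ hC x y
  have hUx : ∀ x, StronglyMeasurable (U x) := fun x ↦ hU.of_uncurry_left
  have hUy : ∀ y, StronglyMeasurable fun x ↦ U x y := fun y ↦ hU.of_uncurry_right
  have iUU : Integrable (Function.uncurry U) (μ.prod ν) :=
    .of_bound hU.aestronglyMeasurable C (.of_forall fun z ↦ hC z.1 z.2)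
  have hmh : m = ∫ y, h y ∂ν := integral_integral_swap iUU
  have ig : Integrable g μ := .of_bound hgm.aestronglyMeasurable C (.of_forall hgC)
  have ih : Integrable h ν := .of_bound hhm.aestronglyMeasurable C (.of_forall hhC)
  have ig2 : Integrable (fun x ↦ g x ^ 2) μ :=
    .of_bound (hgm.pow 2).aestronglyMeasurable (C ^ 2)
      (.of_forall fun x ↦ abs_sq_le_of_abs_le (hgC x))
  have hWb : ∀ x y, |U x y - h y| ≤ C + C := fun x y ↦
    (abs_sub _ _).trans (add_le_add (hC x y) (hhC y))
  have hWm : StronglyMeasurable (Function.uncurry fun x y ↦ U x y - h y) :=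
    hU.sub (hhm.comp_measurable measurable_snd)
  have iW2 : Integrable (Function.uncurry fun x y ↦ (U x y - h y) ^ 2) (μ.prod ν) :=
    .of_bound (hWm.pow 2).aestronglyMeasurable ((C + C) ^ 2)
      (.of_forall fun z ↦ abs_sq_le_of_abs_le (hWb z.1 z.2))
  have jensen : ∀ x, (g x - m) ^ 2 ≤ ∫ y, (U x y - h y) ^ 2 ∂ν := by
    intro x
    have iUx : Integrable (U x) ν := .of_bound (hUx x).aestronglyMeasurable C (.of_forall (hC x))
    have iWx : Integrable (fun y ↦ U x y - h y) ν := iUx.sub ih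
    have iWx2 : Integrable (fun y ↦ (U x y - h y) ^ 2) ν :=
      .of_bound (((hUx x).sub hhm).pow 2).aestronglyMeasurable ((C + C) ^ 2)
        (.of_forall fun y ↦ abs_sq_le_of_abs_le (hWb x y))
    have e1 : ∫ y, (U x y - h y) ∂ν = g x - m := by rw [integral_sub iUx ih, hmh]
    have e2 := integral_sub_const_sq iWx iWx2 (g x - m)
    have e3 : 0 ≤ ∫ y, (U x y - h y - (g x - m)) ^ 2 ∂ν := integral_nonneg fun y ↦ sq_nonneg _
    rw [e2, e1] at e3
    linarith
  have e1 := integral_sub_const_sq ig ig2 m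
  have e2 : ∫ x, (g x - m) ^ 2 ∂μ ≤ ∫ x, ∫ y, (U x y - h y) ^ 2 ∂ν ∂μ := by
    refine integral_mono_of_nonneg (.of_forall fun x ↦ sq_nonneg _) iW2.integral_prod_left
      (.of_forall jensen)
  rw [integral_integral_swap iW2, e1, ← hm] at e2
  have e3 : ∀ y, ∫ x, (U x y - h y) ^ 2 ∂μ = ∫ x, U x y ^ 2 ∂μ - h y ^ 2 := by
    intro y
    rw [integral_sub_const_sq
      (.of_bound (hUy y).aestronglyMeasurable C (.of_forall fun x ↦ hC x y))
      (.of_bound ((hUy y).pow 2).aestronglyMeasurable (C ^ 2)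
        (.of_forall fun x ↦ abs_sq_le_of_abs_le (hC x y)))]
    ring
  simp only [e3] at e2
  linarith

theorem integral_pi_succ {μ : Measure ℝ} [IsProbabilityMeasure μ] {n : ℕ}
    {F : (Fin (n + 1) → ℝ) → ℝ} (hF : Continuous F) {C : ℝ} (hC : ∀ x, |F x| ≤ C) :
    ∫ z, F z ∂Measure.pi (fun _ ↦ μ) =
      ∫ x, ∫ y, F (Fin.cons x y) ∂Measure.pi (fun _ : Fin n ↦ μ) ∂μ := by
  rw [← ((measurePreserving_piFinSuccAbove (fun _ : Fin (n + 1) ↦ μ) 0).symm).integral_comp',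
    integral_prod]
  · simp [MeasurableEquiv.piFinSuccAbove_symm_apply, Fin.insertNthEquiv]
  · exact integrable_of_continuous_of_bound (g := fun z : ℝ × (Fin n → ℝ) ↦ F (Fin.insertNth 0 z.1 z.2))
      (by simpa using continuous_comp_finCons hF) (fun z ↦ hC _)

/-- Poincaré inequality for products of the logistic measure. -/
theorem pi_logisticMeasure_poincare (n : ℕ) : ∀ {u : (Fin n → ℝ) → ℝ}
    {D : Fin n → (Fin n → ℝ) → ℝ} {C : ℝ}, Continuous u → (∀ i, Continuous (D i)) →
    (∀ x, |u x| ≤ C) → (∀ i x, |D i x| ≤ C) →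
    (∀ x i, HasDerivAt (fun s ↦ u (Function.update x i s)) (D i x) (x i)) →
    ∫ x, u x ^ 2 ∂Measure.pi (fun _ ↦ logisticMeasure) -
        (∫ x, u x ∂Measure.pi (fun _ ↦ logisticMeasure)) ^ 2 ≤
      8 * ∑ i, ∫ x, D i x ^ 2 ∂Measure.pi (fun _ ↦ logisticMeasure) := by
  induction n with
  | zero =>
    intro u D C hu hD hC hC' hder
    have : u = fun _ ↦ u 0 := funext fun x ↦ congrArg u (Subsingleton.elim _ _)
    rw [this]
    simp
  | succ n ih =>
    intro u D C hu hD hC hC' hder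
    set P := Measure.pi fun _ : Fin n ↦ logisticMeasure
    have intble : ∀ {F : (Fin (n + 1) → ℝ) → ℝ}, Continuous F → (∀ x, |F x| ≤ C) →
        Integrable (fun z : ℝ × (Fin n → ℝ) ↦ F (Fin.cons z.1 z.2) ^ 2)
          (logisticMeasure.prod P) := fun hF hb ↦
      integrable_of_continuous_of_bound ((continuous_comp_finCons hF).pow 2) fun z ↦ abs_sq_le_of_abs_le (hb _)
    have hsucc : ∀ {F : (Fin (n + 1) → ℝ) → ℝ}, Continuous F → (∀ x, |F x| ≤ C) →
        ∫ x, F x ^ 2 ∂Measure.pi (fun _ ↦ logisticMeasure) =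
          ∫ x, ∫ y, F (Fin.cons x y) ^ 2 ∂P ∂logisticMeasure := fun {F} hF hb ↦
      integral_pi_succ (F := fun x ↦ F x ^ 2) (hF.pow 2) fun x ↦ abs_sq_le_of_abs_le (hb x)
    rw [hsucc hu hC, integral_pi_succ hu hC, Fin.sum_univ_succ, hsucc (hD 0) (hC' 0)]
    simp only [fun i : Fin n ↦ hsucc (hD i.succ) (hC' i.succ)]
    have inner : ∀ x, ∫ y, u (Fin.cons x y) ^ 2 ∂P ≤ (∫ y, u (Fin.cons x y) ∂P) ^ 2 +
        8 * ∑ i : Fin n, ∫ y, D i.succ (Fin.cons x y) ^ 2 ∂P := by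
      intro x
      have cx : Continuous fun y : Fin n → ℝ ↦ (x, y) := by fun_prop
      have := ih (u := fun y ↦ u (Fin.cons x y)) (D := fun i y ↦ D i.succ (Fin.cons x y)) (C := C)
        ((continuous_comp_finCons hu).comp cx) (fun i ↦ (continuous_comp_finCons (hD i.succ)).comp cx) (fun y ↦ hC _) (fun i y ↦ hC' _ _)
        (fun y i ↦ by simpa [Fin.cons_update] using hder (Fin.cons x y) i.succ)
      linarith
    have outer : ∀ y, ∫ x, u (Fin.cons x y) ^ 2 ∂logisticMeasure -
        (∫ x, u (Fin.cons x y) ∂logisticMeasure) ^ 2 ≤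
          8 * ∫ x, D 0 (Fin.cons x y) ^ 2 ∂logisticMeasure := by
      intro y
      have cy : Continuous fun x : ℝ ↦ (x, y) := by fun_prop
      exact logisticMeasure_poincare (u := fun x ↦ u (Fin.cons x y))
        (u' := fun x ↦ D 0 (Fin.cons x y)) (C := C)
        (fun x ↦ by simpa using hder (Fin.cons x y) 0)
        ((continuous_comp_finCons (hD 0)).comp cy) (fun x ↦ hC _) (fun x ↦ hC' _ _)
    have marg := variance_marginal_le (μ := logisticMeasure) (ν := P)
      (U := fun x y ↦ u (Fin.cons x y)) (continuous_comp_finCons hu).measurable.stronglyMeasurable (fun x y ↦ hC _)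
    have gm : StronglyMeasurable fun x ↦ ∫ y, u (Fin.cons x y) ∂P :=
      StronglyMeasurable.integral_prod_right (f := fun x y ↦ u (Fin.cons x y))
        (continuous_comp_finCons hu).measurable.stronglyMeasurable
    have hm : StronglyMeasurable fun y ↦ ∫ x, u (Fin.cons x y) ∂logisticMeasure :=
      StronglyMeasurable.integral_prod_left (f := fun x y ↦ u (Fin.cons x y))
        (continuous_comp_finCons hu).measurable.stronglyMeasurable
    have ig2 : Integrable (fun x ↦ (∫ y, u (Fin.cons x y) ∂P) ^ 2) logisticMeasure :=
      .of_bound (gm.pow 2).aestronglyMeasurable (C ^ 2) (.of_forall fun x ↦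
        abs_sq_le_of_abs_le (abs_integral_le_of_abs_le fun y ↦ hC _))
    have ih2 : Integrable (fun y ↦ (∫ x, u (Fin.cons x y) ∂logisticMeasure) ^ 2) P :=
      .of_bound (hm.pow 2).aestronglyMeasurable (C ^ 2) (.of_forall fun y ↦
        abs_sq_le_of_abs_le (abs_integral_le_of_abs_le fun x ↦ hC _))
    have iD : ∀ i, Integrable (fun x ↦ ∫ y, D i (Fin.cons x y) ^ 2 ∂P) logisticMeasure :=
      fun i ↦ (intble (hD i) (hC' i)).integral_prod_left
    have iS : Integrable (fun x ↦ 8 * ∑ i : Fin n, ∫ y, D i.succ (Fin.cons x y) ^ 2 ∂P)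
        logisticMeasure := (integrable_finsetSum _ fun i _ ↦ iD i.succ).const_mul 8
    have h1 := integral_mono (intble hu hC).integral_prod_left (ig2.add iS) inner
    have h2 := integral_mono ((intble hu hC).integral_prod_right.sub ih2)
      ((intble (hD 0) (hC' 0)).integral_prod_right.const_mul 8) outer
    simp only [Pi.add_apply, Pi.sub_apply] at h1 h2
    rw [integral_add ig2 iS, integral_const_mul,
      integral_finsetSum _ fun i _ ↦ iD i.succ] at h1
    rw [integral_const_mul, ← integral_integral_swap (intble (hD 0) (hC' 0))] at h2
    linarith

theorem pi_logisticMeasure_eq (n : ℕ) : Measure.pi (fun _ : Fin n ↦ logisticMeasure) =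
    volume.withDensity fun z : Fin n → ℝ ↦ ENNReal.ofReal (∏ i, logisticDensity (z i)) := by
  refine Measure.pi_eq (μ := fun _ : Fin n ↦ logisticMeasure) fun s hs ↦ ?_
  have hnn : ∀ x, 0 ≤ logisticDensity x := fun x ↦ (logisticDensity_pos x).le
  rw [withDensity_apply _ (MeasurableSet.univ_pi hs), volume_pi, Measure.restrict_pi_pi,
    ← ofReal_integral_eq_lintegral_ofReal
      (Integrable.fintype_prod (μ := fun i ↦ volume.restrict (s i)) (f := fun _ ↦ logisticDensity)
        fun i ↦ integrable_logisticDensity.restrict)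
      (.of_forall fun z ↦ Finset.prod_nonneg fun i _ ↦ hnn _),
    integral_fintype_prod_eq_prod (f := fun _ ↦ logisticDensity),
    ENNReal.ofReal_prod_of_nonneg fun i _ ↦ integral_nonneg hnn]
  refine Finset.prod_congr rfl fun i _ ↦ ?_
  rw [logisticMeasure, withDensity_apply _ (hs i), ofReal_integral_eq_lintegral_ofReal
    integrable_logisticDensity.restrict (.of_forall hnn)]

theorem integral_pi_logisticMeasure {n : ℕ} (F : (Fin n → ℝ) → ℝ) :
    ∫ z, F z ∂Measure.pi (fun _ ↦ logisticMeasure) =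
      ∫ z, F z * ∏ i, logisticDensity (z i) := by
  have hm : Measurable fun z : Fin n → ℝ ↦ ENNReal.ofReal (∏ i, logisticDensity (z i)) :=
    (Finset.measurable_prod _ fun i _ ↦
      continuous_logisticDensity.measurable.comp (measurable_pi_apply i)).ennreal_ofReal
  rw [pi_logisticMeasure_eq, integral_withDensity_eq_integral_toReal_smul hm (by simp)]
  refine integral_congr_ae (.of_forall fun z ↦ ?_)
  simp only [smul_eq_mul]
  rw [ENNReal.toReal_ofReal (Finset.prod_nonneg fun i _ ↦ (logisticDensity_pos _).le), mul_comm]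

theorem exp_logisticPsi (x : ℝ) : Real.exp (logisticPsi x) = logisticDensity x :=
  Real.exp_log (logisticDensity_pos x)

theorem deriv_deriv_logisticPsi (x : ℝ) :
    deriv (deriv logisticPsi) x = -2 * logisticDensity x := by
  have hpsi : logisticPsi = fun x ↦ x - 2 * Real.log (1 + Real.exp x) := by
    ext x
    have := Real.exp_pos x
    rw [logisticPsi, logisticDensity, Real.log_div (by positivity) (by positivity), Real.log_exp,
      Real.log_pow]
    norm_num
  have h1 : deriv logisticPsi = fun x ↦ 1 - 2 * (Real.exp x / (1 + Real.exp x)) := by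
    ext x
    have := Real.exp_pos x
    rw [hpsi]
    exact ((hasDerivAt_id x).sub
      ((((Real.hasDerivAt_exp x).const_add 1).log (by positivity)).const_mul 2)).deriv
  have hp := Real.exp_pos x
  have h2 : HasDerivAt (fun x ↦ 1 - 2 * (Real.exp x / (1 + Real.exp x))) _ x :=
    ((((Real.hasDerivAt_exp x).div ((Real.hasDerivAt_exp x).const_add 1)
      (by positivity))).const_mul 2).const_sub 1
  rw [h1, h2.deriv, logisticDensity]
  field_simp
  ring

theorem logisticDensity_le_of_le_abs {t : ℝ} (ht : 2 * Real.log (2 + √3) ≤ |t|) :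
    logisticDensity t ≤ 1 / 16 := by
  have h3 : √3 ^ 2 = 3 := Real.sq_sqrt (by norm_num)
  have h0 : 0 ≤ √3 := Real.sqrt_nonneg 3
  have hlog : Real.log (2 + √3) ≤ |t / 2| := by
    rw [abs_div, abs_two]; linarith
  have hc : 2 ≤ Real.cosh (t / 2) := by
    have e : Real.cosh (Real.log (2 + √3)) = 2 := by
      rw [Real.cosh_log (by positivity)]
      field_simp
      nlinarith
    refine e.symm.trans_le (Real.cosh_le_cosh.2 ?_)
    rwa [abs_of_nonneg (Real.log_nonneg (by linarith))]
  rw [logisticDensity_eq]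
  apply one_div_le_one_div_of_le (by norm_num)
  nlinarith

/-- Stability inequality in arbitrary Euclidean coordinates on the boundary hyperplane. -/
theorem weighted_poincare_of_isometry {N : ℕ}
    (Q : EuclideanSpace ℝ (Fin N) ≃ₗᵢ[ℝ] EuclideanSpace ℝ (Fin N)) (b : EuclideanSpace ℝ (Fin N))
    {u : EuclideanSpace ℝ (Fin N) → ℝ} (hu : ContDiff ℝ 1 u) (hsupp : HasCompactSupport u)
    (hmean : ∫ z, u z * ∏ i, logisticDensity ((Q z + b) i) = 0) {c : ℝ} (hc : c ≤ 1 / 8) :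
    0 ≤ ∫ z, (‖gradient u z‖ ^ 2 - c * u z ^ 2) * ∏ i, logisticDensity ((Q z + b) i) := by
  let e : EuclideanSpace ℝ (Fin N) ≃ₜ (Fin N → ℝ) :=
    (Q.toHomeomorph.trans (Homeomorph.addRight b)).trans
      (PiLp.homeomorph 2 fun _ : Fin N ↦ ℝ)
  have he : ∀ z i, e z i = (Q z + b) i := fun z i ↦ rfl
  have hmp : MeasurePreserving e volume volume :=
    ((PiLp.volume_preserving_ofLp (Fin N)).comp
      (measurePreserving_add_right volume b)).comp Q.measurePreserving
  have transfer : ∀ F : (Fin N → ℝ) → ℝ, ∫ z, F (e z) * ∏ i, logisticDensity ((Q z + b) i) =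
      ∫ y, F y ∂Measure.pi (fun _ ↦ logisticMeasure) := by
    intro F
    rw [integral_pi_logisticMeasure,
      ← hmp.integral_comp e.measurableEmbedding fun y ↦ F y * ∏ i, logisticDensity (y i)]
    simp only [he]
  have hgrad : Continuous (gradient u) :=
    (InnerProductSpace.toDual ℝ _).symm.continuous.comp (hu.continuous_fderiv one_ne_zero)
  have hgsupp : HasCompactSupport (gradient u) :=
    (hsupp.fderiv ℝ).comp_left (g := (InnerProductSpace.toDual ℝ _).symm) (map_zero _)
  obtain ⟨C₁, hC₁⟩ := hsupp.exists_bound_of_continuous hu.continuous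
  obtain ⟨C₂, hC₂⟩ := hgsupp.exists_bound_of_continuous hgrad
  have hDcont : ∀ i, Continuous fun y ↦ Q (gradient u (e.symm y)) i := by
    intro i
    have : Continuous fun y ↦ Q (gradient u (e.symm y)) :=
      Q.continuous.comp (hgrad.comp e.symm.continuous)
    fun_prop
  have hDb : ∀ i y, |Q (gradient u (e.symm y)) i| ≤ max C₁ C₂ := fun i y ↦ by
    have := PiLp.norm_apply_le (Q (gradient u (e.symm y))) i
    rw [Q.norm_map] at this
    exact (this.trans (hC₂ _)).trans (le_max_right _ _)
  have hub : ∀ y, |u (e.symm y)| ≤ max C₁ C₂ := fun y ↦ (hC₁ _).trans (le_max_left _ _)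
  have hder : ∀ y i, HasDerivAt (fun s ↦ u (e.symm (Function.update y i s)))
      (Q (gradient u (e.symm y)) i) (y i) := by
    intro y i
    have h1 : ∀ s, e.symm (Function.update y i s) =
        e.symm y + (s - y i) • Q.symm (EuclideanSpace.single i 1) := by
      intro s
      rw [Homeomorph.symm_apply_eq]
      ext j
      have h2 : (Q (e.symm y) + b) j = y j := by rw [← he, e.apply_symm_apply]
      rw [PiLp.add_apply] at h2
      rw [he, map_add, map_smul, Q.apply_symm_apply, PiLp.add_apply, PiLp.add_apply,
        PiLp.smul_apply]
      rcases eq_or_ne j i with rfl | hj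
      · simp; linarith
      · simp [hj, h2]
    simp only [h1]
    have h3 : HasDerivAt (fun s ↦ e.symm y + (s - y i) • Q.symm (EuclideanSpace.single i 1))
        (Q.symm (EuclideanSpace.single i 1)) (y i) := by
      simpa using ((((hasDerivAt_id (y i)).sub_const (y i)).smul_const
        (Q.symm (EuclideanSpace.single i (1 : ℝ)))).const_add (e.symm y))
    have h4 : HasFDerivAt u (InnerProductSpace.toDual ℝ _ (gradient u (e.symm y)))
        (e.symm y + (y i - y i) • Q.symm (EuclideanSpace.single i 1)) := by
      rw [sub_self, zero_smul, add_zero]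
      exact ((hu.differentiable one_ne_zero) _).hasGradientAt.hasFDerivAt
    have h5 := h4.comp_hasDerivAt (y i) h3
    have h6 : InnerProductSpace.toDual ℝ _ (gradient u (e.symm y))
        (Q.symm (EuclideanSpace.single i 1)) = Q (gradient u (e.symm y)) i := by
      rw [InnerProductSpace.toDual_apply_apply, ← Q.inner_map_map, Q.apply_symm_apply,
        EuclideanSpace.inner_single_right]
      simp
    rw [h6] at h5
    exact h5
  have key := pi_logisticMeasure_poincare N (u := fun y ↦ u (e.symm y))
    (D := fun i y ↦ Q (gradient u (e.symm y)) i)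
    (hu.continuous.comp e.symm.continuous) hDcont hub hDb hder
  have hm0 := transfer fun y ↦ u (e.symm y)
  simp only [e.symm_apply_apply] at hm0
  rw [← hm0, hmean] at key
  have hfin := transfer fun y ↦ ∑ i, Q (gradient u (e.symm y)) i ^ 2 - c * u (e.symm y) ^ 2
  have hnorm : ∀ z, ∑ i, Q (gradient u z) i ^ 2 = ‖gradient u z‖ ^ 2 := fun z ↦ by
    rw [← Q.norm_map, EuclideanSpace.real_norm_sq_eq]
  simp only [e.symm_apply_apply, hnorm] at hfin
  have iu2 : Integrable (fun y ↦ u (e.symm y) ^ 2)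
      (Measure.pi fun _ : Fin N ↦ logisticMeasure) :=
    integrable_of_continuous_of_bound ((hu.continuous.comp e.symm.continuous).pow 2)
      fun y ↦ abs_sq_le_of_abs_le (hub y)
  have iD2 : ∀ i, Integrable (fun y ↦ Q (gradient u (e.symm y)) i ^ 2)
      (Measure.pi fun _ : Fin N ↦ logisticMeasure) := fun i ↦
    integrable_of_continuous_of_bound ((hDcont i).pow 2) fun y ↦ abs_sq_le_of_abs_le (hDb i y)
  rw [hfin]
  simp only [← hnorm]
  rw [integral_sub (integrable_finsetSum _ fun i _ ↦ iD2 i) (iu2.const_mul c),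
    integral_const_mul, integral_finsetSum _ fun i _ ↦ iD2 i]
  have hnn : 0 ≤ ∫ y, u (e.symm y) ^ 2 ∂Measure.pi (fun _ : Fin N ↦ logisticMeasure) :=
    integral_nonneg fun y ↦ sq_nonneg _
  nlinarith

/-- If `|t| ≥ 2 log(2+√3)` then the coordinate half-space
`H_t = {x ∈ ℝ^{N+1} : x_{N+1} < t}` is stable for the product `Λ^{N+1}` of the
logistic measure. -/
theorem logistic_coordinate_halfspace_stable
    (N : ℕ) (t : ℝ) (ht : 2 * Real.log (2 + Real.sqrt 3) ≤ |t|) :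
    HalfSpaceStable (n := N) logisticPsi (EuclideanSpace.single (Fin.last N) 1) t := by
  intro p hp u hu hsupp hmean
  have hlast : ∀ z, p z (Fin.last N) = t := by
    intro z
    have : p z ∈ Set.range p := ⟨z, rfl⟩
    rw [hp] at this
    simpa [Pi.single_apply] using this
  have hpz : ∀ z, p z = p.linearIsometry z + p 0 := fun z ↦ by
    simpa using p.map_vadd 0 z
  have hlin : ∀ z, p.linearIsometry z (Fin.last N) = 0 := fun z ↦ by
    have h := congrArg (fun x : EuclideanSpace ℝ (Fin (N + 1)) ↦ x (Fin.last N)) (hpz z)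
    simpa [hlast] using h
  let L : EuclideanSpace ℝ (Fin N) →ₗᵢ[ℝ] EuclideanSpace ℝ (Fin N) :=
    { toFun := fun z ↦ WithLp.toLp 2 fun i ↦ p.linearIsometry z i.castSucc
      map_add' := fun x y ↦ by ext i; simp
      map_smul' := fun r x ↦ by ext i; simp
      norm_map' := fun z ↦ by
        rw [← sq_eq_sq₀ (norm_nonneg _) (norm_nonneg _), ← p.linearIsometry.norm_map z,
          EuclideanSpace.real_norm_sq_eq, EuclideanSpace.real_norm_sq_eq, Fin.sum_univ_castSucc,
          hlin]
        simp }
  let Q := L.toLinearIsometryEquiv rfl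
  let b : EuclideanSpace ℝ (Fin N) := WithLp.toLp 2 fun i ↦ p 0 i.castSucc
  have hQ : ∀ z i, p z (Fin.castSucc i) = (Q z + b) i := fun z i ↦ by
    rw [hpz]; rfl
  have hprod : ∀ z, ∏ i, Real.exp (logisticPsi (p z i)) =
      (∏ i, logisticDensity ((Q z + b) i)) * logisticDensity t := fun z ↦ by
    simp only [exp_logisticPsi, Fin.prod_univ_castSucc, hlast, hQ]
  have hsum : ∀ z, ∑ i, deriv (deriv logisticPsi) (p z i) *
      (EuclideanSpace.single (Fin.last N) (1 : ℝ)) i ^ 2 = -2 * logisticDensity t := fun z ↦ by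
    simp [hlast, deriv_deriv_logisticPsi]
  have hft := logisticDensity_pos t
  simp only [hprod, ← mul_assoc, integral_mul_const] at hmean
  have key := weighted_poincare_of_isometry Q b (hu.of_le (by simp)) hsupp
    ((mul_eq_zero.1 hmean).resolve_right hft.ne') (c := 2 * logisticDensity t)
    (by linarith [logisticDensity_le_of_le_abs ht])
  simp only [hprod, hsum, ← mul_assoc, integral_mul_const]
  refine mul_nonneg (le_of_le_of_eq key ?_) hft.le
  congr 1
  ext z
  ring
end

section
/- Let f(x) = e^x/(1+e^x)² be the logistic density on ℝ. Then for every odd function u ∈ C¹(ℝ) with ∫_ℝ u²(x) f³(x) dx < ∞, one has ∫_ℝ u²(x) f³(x) dx ≤ (1/6) ∫_ℝ u'²(x) f²(x) dx. (This follows by applying the Brascamp–Lieb inequality to the probability measure dτ(x) = 30 f³(x) dx = e^{−g(x)}·30 dx with g(x) = 3 ln((1+e^x)²/e^x), for which g''(x) = 6 f(x) > 0; odd functions have zero mean with respect to τ since τ is symmetric.) -/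
open MeasureTheory Real
open scoped ENNReal

/-- The score `T(x) = (eˣ - 1)/(eˣ + 1)` of the logistic density,
minus its logarithmic derivative. -/
noncomputable def logisticScore (x : ℝ) : ℝ := (Real.exp x - 1) / (Real.exp x + 1)

theorem hasDerivAt_logisticDensity (x : ℝ) :
    HasDerivAt logisticDensity (-logisticScore x * logisticDensity x) x := by
  have h0 : (1 + Real.exp x) ≠ 0 := by positivity
  have h0' : (Real.exp x + 1) ≠ 0 := by positivity
  have h := (Real.hasDerivAt_exp x).div (((Real.hasDerivAt_exp x).const_add 1).pow 2)
    (pow_ne_zero 2 h0)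
  refine h.congr_deriv ?_
  simp only [logisticScore, logisticDensity, Pi.pow_apply]
  field_simp
  ring

theorem hasDerivAt_logisticScore (x : ℝ) :
    HasDerivAt logisticScore (2 * logisticDensity x) x := by
  have h0 : (1 + Real.exp x) ≠ 0 := by positivity
  have h0' : (Real.exp x + 1) ≠ 0 := by positivity
  have h := ((Real.hasDerivAt_exp x).sub_const 1).div ((Real.hasDerivAt_exp x).add_const 1) h0'
  refine h.congr_deriv ?_
  simp only [logisticDensity]
  field_simp
  ring

theorem logisticScore_zero : logisticScore 0 = 0 := by simp [logisticScore]

theorem logisticScore_pos {x : ℝ} (hx : 0 < x) : 0 < logisticScore x := by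
  have := Real.one_lt_exp_iff.2 hx
  exact div_pos (by linarith) (by positivity)

theorem logisticScore_neg {x : ℝ} (hx : x < 0) : logisticScore x < 0 := by
  have := Real.exp_lt_one_iff.2 hx
  exact div_neg_of_neg_of_pos (by linarith) (by positivity)

theorem logisticScore_ne_zero {x : ℝ} (hx : x ≠ 0) : logisticScore x ≠ 0 :=
  hx.lt_or_gt.elim (fun h => (logisticScore_neg h).ne) (fun h => (logisticScore_pos h).ne')

/-- The boundary term `2 u² f³ / T` in the weighted Poincaré inequality. -/
noncomputable def logisticBoundary (u : ℝ → ℝ) (x : ℝ) : ℝ :=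
  2 * (u x ^ 2 * logisticDensity x ^ 3) / logisticScore x

theorem hasDerivAt_logisticBoundary {u : ℝ → ℝ} {u' x : ℝ} (hu : HasDerivAt u u' x) (hx : x ≠ 0) :
    HasDerivAt (logisticBoundary u)
      (4 * u x * u' * logisticDensity x ^ 3 / logisticScore x - 6 * u x ^ 2 * logisticDensity x ^ 3
        - 4 * u x ^ 2 * logisticDensity x ^ 4 / logisticScore x ^ 2) x := by
  have hT := logisticScore_ne_zero hx
  have h := (((hu.pow 2).mul ((hasDerivAt_logisticDensity x).pow 3)).const_mul 2).div
    (hasDerivAt_logisticScore x) hT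
  refine h.congr_deriv ?_
  simp only [Pi.pow_apply, Pi.mul_apply]
  field_simp
  ring

theorem continuous_logisticBoundary {u : ℝ → ℝ} (hu : Differentiable ℝ u) (hu0 : u 0 = 0) :
    Continuous (logisticBoundary u) := by
  refine continuous_iff_continuousAt.2 fun x => ?_
  rcases eq_or_ne x 0 with rfl | hx
  · have hslope := hasDerivAt_iff_tendsto_slope_zero.1 (hu 0).hasDerivAt
    have hslopeT := hasDerivAt_iff_tendsto_slope_zero.1 (hasDerivAt_logisticScore 0)
    have hquot := hslope.div hslopeT (mul_pos two_pos (logisticDensity_pos 0)).ne'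
    have hreg : Filter.Tendsto (fun x => 2 * (u x * logisticDensity x ^ 3))
        (nhdsWithin 0 {0}ᶜ) (nhds 0) := by
      have hc : Continuous (fun x => 2 * (u x * logisticDensity x ^ 3)) :=
        continuous_const.mul (hu.continuous.mul (continuous_logisticDensity.pow 3))
      have := (hc.tendsto 0).mono_left (nhdsWithin_le_nhds (s := {0}ᶜ))
      simpa [hu0] using this
    have hprod := hreg.mul hquot
    rw [zero_mul] at hprod
    rw [continuousAt_iff_punctured_nhds]
    have h0 : logisticBoundary u 0 = 0 := by simp [logisticBoundary, hu0]
    rw [h0]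
    refine hprod.congr' ?_
    filter_upwards [self_mem_nhdsWithin] with x hx
    have hx : x ≠ 0 := hx
    have hT := logisticScore_ne_zero hx
    simp only [zero_add, hu0, logisticScore_zero, sub_zero, smul_eq_mul, logisticBoundary,
      Pi.div_apply]
    field_simp
  · exact (hasDerivAt_logisticBoundary (hu x).hasDerivAt hx).continuousAt

theorem logisticBoundary_sub_le_integral {u : ℝ → ℝ} (hu : ContDiff ℝ 1 u) (hu0 : u 0 = 0)
    {a b : ℝ} (hab : a ≤ b) (h0 : (0 : ℝ) ∉ Set.Ioo a b) :
    logisticBoundary u b - logisticBoundary u a ≤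
      ∫ x in a..b, (deriv u x ^ 2 * logisticDensity x ^ 2
        - 6 * (u x ^ 2 * logisticDensity x ^ 3)) := by
  have hd : Differentiable ℝ u := hu.differentiable one_ne_zero
  have hc : Continuous (fun x => deriv u x ^ 2 * logisticDensity x ^ 2
      - 6 * (u x ^ 2 * logisticDensity x ^ 3)) :=
    (((hu.continuous_deriv le_rfl).pow 2).mul (continuous_logisticDensity.pow 2)).sub
      (continuous_const.mul ((hu.continuous.pow 2).mul (continuous_logisticDensity.pow 3)))
  have hne : ∀ x ∈ Set.Ioo a b, x ≠ 0 := fun x hx h => h0 (h ▸ hx)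
  refine intervalIntegral.sub_le_integral_of_hasDeriv_right_of_le hab
    (continuous_logisticBoundary hd hu0).continuousOn
    (fun x hx => (hasDerivAt_logisticBoundary (hd x).hasDerivAt (hne x hx)).hasDerivWithinAt)
    hc.continuousOn.integrableOn_Icc fun x hx => ?_
  have hT := logisticScore_ne_zero (hne x hx)
  have hsq := sq_nonneg (deriv u x * logisticDensity x
    - 2 * u x * logisticDensity x ^ 2 / logisticScore x)
  have hexpand : (deriv u x * logisticDensity x
      - 2 * u x * logisticDensity x ^ 2 / logisticScore x) ^ 2
      = deriv u x ^ 2 * logisticDensity x ^ 2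
        - 4 * u x * deriv u x * logisticDensity x ^ 3 / logisticScore x
        + 4 * u x ^ 2 * logisticDensity x ^ 4 / logisticScore x ^ 2 := by
    field_simp
    ring
  linarith

/-- The weighted Poincaré inequality on a symmetric interval, for functions vanishing at `0`. -/
theorem integral_sq_mul_logisticDensity_le {u : ℝ → ℝ} (hu : ContDiff ℝ 1 u) (hu0 : u 0 = 0)
    {b : ℝ} (hb : 0 ≤ b) :
    ∫ x in (-b)..b, u x ^ 2 * logisticDensity x ^ 3 ≤
      1 / 6 * ∫ x in (-b)..b, deriv u x ^ 2 * logisticDensity x ^ 2 := by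
  have hc₁ : Continuous (fun x => u x ^ 2 * logisticDensity x ^ 3) :=
    (hu.continuous.pow 2).mul (continuous_logisticDensity.pow 3)
  have hc₂ : Continuous (fun x => deriv u x ^ 2 * logisticDensity x ^ 2) :=
    ((hu.continuous_deriv le_rfl).pow 2).mul (continuous_logisticDensity.pow 2)
  have hc₆ : Continuous (fun x => 6 * (u x ^ 2 * logisticDensity x ^ 3)) := continuous_const.mul hc₁
  have hc := hc₂.sub hc₆
  have hright := logisticBoundary_sub_le_integral hu hu0 hb (by simp)
  have hleft := logisticBoundary_sub_le_integral hu hu0 (neg_nonpos.2 hb) (by simp)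
  have hsum := intervalIntegral.integral_add_adjacent_intervals
    (hc.intervalIntegrable (μ := volume) (-b) 0) (hc.intervalIntegrable (μ := volume) 0 b)
  simp only [Pi.sub_apply] at hsum
  rw [intervalIntegral.integral_sub (hc₂.intervalIntegrable (-b) b)
    (hc₆.intervalIntegrable (-b) b),
    intervalIntegral.integral_const_mul] at hsum
  have hw : ∀ x, 0 ≤ 2 * (u x ^ 2 * logisticDensity x ^ 3) := fun x => by
    have := logisticDensity_pos x
    positivity
  have hsign : logisticBoundary u (-b) ≤ 0 ∧ 0 ≤ logisticBoundary u b := by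
    rcases hb.eq_or_lt with rfl | hb
    · simp [logisticBoundary, hu0]
    · exact ⟨div_nonpos_of_nonneg_of_nonpos (hw _) (logisticScore_neg (neg_lt_zero.2 hb)).le,
        div_nonneg (hw _) (logisticScore_pos hb).le⟩
  linarith [hsign.1, hsign.2]

theorem setLIntegral_Ioc_ofReal_eq {h : ℝ → ℝ} (hc : Continuous h) (h0 : ∀ x, 0 ≤ h x)
    {a b : ℝ} (hab : a ≤ b) :
    ∫⁻ x in Set.Ioc a b, ENNReal.ofReal (h x) = ENNReal.ofReal (∫ x in a..b, h x) := by
  rw [intervalIntegral.integral_of_le hab]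
  exact (ofReal_integral_eq_lintegral_ofReal
    ((intervalIntegrable_iff_integrableOn_Ioc_of_le hab).1 (hc.intervalIntegrable a b))
    (Filter.Eventually.of_forall h0)).symm

/-- A weighted Poincaré-type inequality for the logistic density, obtained from the
Brascamp–Lieb inequality applied to the probability measure `dτ = 30 f³ dx`: every odd
`C¹` function `u` with `∫ u² f³ dx < ∞` satisfies
`∫ u² f³ dx ≤ (1/6) ∫ u'² f² dx`. -/
theorem logistic_odd_weighted_poincare
    (u : ℝ → ℝ) (hu : ContDiff ℝ 1 u) (hodd : ∀ x, u (-x) = -u x)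
    (hfin : (∫⁻ x : ℝ, ENNReal.ofReal (u x ^ 2 * logisticDensity x ^ 3)) < ⊤) :
    (∫⁻ x : ℝ, ENNReal.ofReal (u x ^ 2 * logisticDensity x ^ 3)) ≤
      (1 / 6 : ℝ≥0∞) * ∫⁻ x : ℝ, ENNReal.ofReal (deriv u x ^ 2 * logisticDensity x ^ 2) := by
  have hu0 : u 0 = 0 := by
    have := hodd 0
    rw [neg_zero] at this
    linarith
  have hc₁ : Continuous (fun x => u x ^ 2 * logisticDensity x ^ 3) :=
    (hu.continuous.pow 2).mul (continuous_logisticDensity.pow 3)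
  have hc₂ : Continuous (fun x => deriv u x ^ 2 * logisticDensity x ^ 2) :=
    ((hu.continuous_deriv le_rfl).pow 2).mul (continuous_logisticDensity.pow 2)
  have hcover : AECover volume Filter.atTop (fun n : ℕ => Set.Ioc (-(n : ℝ)) n) :=
    aecover_Ioc (Filter.tendsto_neg_atTop_atBot.comp tendsto_natCast_atTop_atTop)
      tendsto_natCast_atTop_atTop
  refine le_of_tendsto' (hcover.lintegral_tendsto_of_countably_generated
    hc₁.measurable.ennreal_ofReal.aemeasurable) fun n => ?_
  have hn : (0 : ℝ) ≤ n := n.cast_nonneg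
  have hn' : -(n : ℝ) ≤ n := by linarith
  have hsixth : (1 / 6 : ℝ≥0∞) = ENNReal.ofReal (1 / 6) := by
    rw [ENNReal.ofReal_div_of_pos (by norm_num)]
    simp
  calc ∫⁻ x in Set.Ioc (-(n : ℝ)) n, ENNReal.ofReal (u x ^ 2 * logisticDensity x ^ 3)
      = ENNReal.ofReal (∫ x in (-(n : ℝ))..n, u x ^ 2 * logisticDensity x ^ 3) :=
        setLIntegral_Ioc_ofReal_eq hc₁
          (fun x => mul_nonneg (sq_nonneg _) (pow_nonneg (logisticDensity_pos x).le 3)) hn'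
    _ ≤ ENNReal.ofReal (1 / 6 * ∫ x in (-(n : ℝ))..n, deriv u x ^ 2 * logisticDensity x ^ 2) :=
        ENNReal.ofReal_le_ofReal (integral_sq_mul_logisticDensity_le hu hu0 hn)
    _ = 1 / 6 * ∫⁻ x in Set.Ioc (-(n : ℝ)) n,
          ENNReal.ofReal (deriv u x ^ 2 * logisticDensity x ^ 2) := by
        rw [ENNReal.ofReal_mul (by norm_num), hsixth, setLIntegral_Ioc_ofReal_eq hc₂
          (fun x => mul_nonneg (sq_nonneg _) (sq_nonneg _)) hn']
    _ ≤ _ := by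
        gcongr
        exact Measure.restrict_le_self
end
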